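/- arXiv:1512.01490 — 3 statements merged into one kernel-verified Lean document; each statement's English description precedes it below -/
import Mathlib

section
/- Let β > n and let X be a random vector in ℝⁿ with (-1/β)-concave density f. Then for all α < 1 - n/β, E[exp(α(h̃(X) - h(X)))] ≤ exp(ψ_c(α)), where h̃(X) = -log f(X), h(X) = E[h̃(X)], and ψ_c(α) = -αβ ∑_{i=1}^n (β-i)^{-1} - ∑_{i=1}^n log(((1-α)β - i)/(β - i)). -/
open MeasureTheory ProbabilityTheory Real
open scoped ENNReal Pointwise

/-- The one-dimensional **Brunn–Minkowski inequality**. -/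
lemma volume_add_volume_le {A B C : Set ℝ} (hA : MeasurableSet A) (hB : MeasurableSet B)
    (hA0 : A.Nonempty) (hB0 : B.Nonempty) (hC : ∀ x ∈ A, ∀ y ∈ B, x + y ∈ C) :
    volume A + volume B ≤ volume C := by
  obtain ⟨a₀, ha₀⟩ := hA0
  obtain ⟨b₀, hb₀⟩ := hB0
  rw [hA.measure_eq_iSup_isCompact, hB.measure_eq_iSup_isCompact]
  simp only [iSup_and']
  refine ENNReal.biSup_add_biSup_le' ⟨∅, by simp⟩ ⟨∅, by simp⟩ ?_
  rintro K ⟨hKA, hK⟩ L ⟨hLB, hL⟩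
  have hK' : IsCompact (insert a₀ K) := hK.insert a₀
  have hL' : IsCompact (insert b₀ L) := hL.insert b₀
  have hKA' : insert a₀ K ⊆ A := Set.insert_subset ha₀ hKA
  have hLB' : insert b₀ L ⊆ B := Set.insert_subset hb₀ hLB
  obtain ⟨m, hm, hm'⟩ := hK'.exists_isGreatest (Set.insert_nonempty _ _)
  obtain ⟨l, hl, hl'⟩ := hL'.exists_isLeast (Set.insert_nonempty _ _)
  have hdisj : AEDisjoint volume ((fun x ↦ l + x) '' K) ((fun x ↦ m + x) '' L) := by
    refine measure_mono_null (t := {m + l}) ?_ (by simp)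
    rintro _ ⟨⟨x, hx, rfl⟩, ⟨y, hy, hxy⟩⟩
    have h1 := hm' (Set.mem_insert_of_mem _ hx)
    have h2 := hl' (Set.mem_insert_of_mem _ hy)
    simp only [Set.mem_singleton_iff] at *
    linarith
  have hmeas : MeasurableSet ((fun x ↦ m + x) '' L) :=
    (hL.image (continuous_const_add m)).measurableSet
  calc volume K + volume L
      = volume ((fun x ↦ l + x) '' K) + volume ((fun x ↦ m + x) '' L) := by
        rw [Set.image_add_left, Set.image_add_left, measure_preimage_add, measure_preimage_add]
    _ = volume ((fun x ↦ l + x) '' K ∪ (fun x ↦ m + x) '' L) :=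
        (measure_union₀ hmeas.nullMeasurableSet hdisj).symm
    _ ≤ volume C := by
        apply measure_mono
        rintro _ (⟨x, hx, rfl⟩ | ⟨y, hy, rfl⟩)
        · simpa [add_comm] using hC x (hKA hx) l (hLB' hl)
        · exact hC m (hKA' hm) y (hLB hy)

lemma mul_volume_add_mul_volume_le {A B C : Set ℝ} (hA : MeasurableSet A) (hB : MeasurableSet B)
    (hA0 : A.Nonempty) (hB0 : B.Nonempty) {a b : ℝ} (ha : 0 < a) (hb : 0 < b)
    (hC : ∀ x ∈ A, ∀ y ∈ B, a * x + b * y ∈ C) :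
    ENNReal.ofReal a * volume A + ENNReal.ofReal b * volume B ≤ volume C := by
  have key := volume_add_volume_le (C := C) (hA.const_smul₀ a) (hB.const_smul₀ b)
    (hA0.image _) (hB0.image _) (by rintro _ ⟨x, hx, rfl⟩ _ ⟨y, hy, rfl⟩; exact hC x hx y hy)
  change volume (a • A) + volume (b • B) ≤ _ at key
  simpa [Measure.addHaar_smul, abs_of_pos ha, abs_of_pos hb] using key

lemma iSup_rpow_mul_iSup_rpow_le {u v : ℕ → ℝ≥0∞} (hu : Monotone u) (hv : Monotone v)
    {a b : ℝ} (ha : 0 < a) (hb : 0 < b) {c : ℝ≥0∞} (h : ∀ k, u k ^ a * v k ^ b ≤ c) :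
    (⨆ k, u k) ^ a * (⨆ k, v k) ^ b ≤ c := by
  have h1 := (ENNReal.orderIsoRpow a ha).map_iSup u
  have h2 := (ENNReal.orderIsoRpow b hb).map_iSup v
  simp only [ENNReal.orderIsoRpow_apply] at h1 h2
  rw [h1, h2, ENNReal.iSup_mul]
  refine iSup_le fun k ↦ ?_
  rw [ENNReal.mul_iSup]
  refine iSup_le fun l ↦ le_trans ?_ (h (max k l))
  gcongr
  · exact hu (le_max_left _ _)
  · exact hv (le_max_right _ _)

lemma lintegral_eq_lintegral_volume_lt {f : ℝ → ℝ≥0∞} (hf : Measurable f) (hf1 : ∀ x, f x ≤ 1) :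
    ∫⁻ x, f x = ∫⁻ t in Set.Ioo (0 : ℝ) 1, volume {x | ENNReal.ofReal t < f x} := by
  have hfin : ∀ x, f x ≠ ∞ := fun x ↦ ne_top_of_le_ne_top ENNReal.one_ne_top (hf1 x)
  have h := lintegral_eq_lintegral_meas_lt volume (f := fun x ↦ (f x).toReal)
    (.of_forall fun x ↦ ENNReal.toReal_nonneg) hf.ennreal_toReal.aemeasurable
  simp only [ENNReal.ofReal_toReal (hfin _)] at h
  rw [h]
  have hsplit : Set.Ioi (0 : ℝ) = Set.Ioo 0 1 ∪ Set.Ici 1 := by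
    ext x; simp
  rw [hsplit, lintegral_union measurableSet_Ici]
  · rw [setLIntegral_congr_fun (g := 0) measurableSet_Ici]
    · simp only [Pi.zero_apply, lintegral_zero, add_zero]
      refine setLIntegral_congr_fun measurableSet_Ioo fun t ht ↦ ?_
      simp only [ENNReal.ofReal_lt_iff_lt_toReal ht.1.le (hfin _)]
    · intro t ht
      have : {x | t < (f x).toReal} = ∅ := by
        ext x
        have := ENNReal.toReal_mono ENNReal.one_ne_top (hf1 x)
        simp at *; linarith
      simp [this]
  · rw [Set.disjoint_left]; intro x hx hx'; simp at *; linarith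

/-- Additive form of the one-dimensional Prékopa–Leindler inequality. -/
lemma prekopa_leindler_real_of_iSup_eq_one {f g h : ℝ → ℝ≥0∞} (hf : Measurable f)
    (hg : Measurable g) (hh : Measurable h) {a b : ℝ} (ha : 0 < a) (hb : 0 < b) (hab : a + b = 1)
    (hf1 : ⨆ x, f x = 1) (hg1 : ⨆ x, g x = 1)
    (H : ∀ x y, f x ^ a * g y ^ b ≤ h (a * x + b * y)) :
    ENNReal.ofReal a * (∫⁻ x, f x) + ENNReal.ofReal b * (∫⁻ x, g x) ≤ ∫⁻ x, h x := by
  have hf1' : ∀ x, f x ≤ 1 := fun x ↦ hf1 ▸ le_iSup f x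
  have hg1' : ∀ x, g x ≤ 1 := fun x ↦ hg1 ▸ le_iSup g x
  have hmono : ∀ F : ℝ → ℝ≥0∞, Measurable (fun t : ℝ ↦ volume {x | ENNReal.ofReal t < F x}) :=
    fun F ↦ Antitone.measurable fun s t hst ↦ measure_mono fun x hx ↦
      lt_of_le_of_lt (ENNReal.ofReal_le_ofReal hst) hx
  calc _ = ∫⁻ t in Set.Ioo (0 : ℝ) 1, (ENNReal.ofReal a * volume {x | ENNReal.ofReal t < f x}
            + ENNReal.ofReal b * volume {x | ENNReal.ofReal t < g x}) := by
        rw [lintegral_eq_lintegral_volume_lt hf hf1', lintegral_eq_lintegral_volume_lt hg hg1',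
          lintegral_add_left ((hmono f).const_mul _), lintegral_const_mul _ (hmono f),
          lintegral_const_mul _ (hmono g)]
    _ ≤ ∫⁻ t in Set.Ioo (0 : ℝ) 1, volume {x | ENNReal.ofReal t < min (h x) 1} := by
        refine setLIntegral_mono (hmono _) fun t ht ↦ ?_
        have ht1 : ENNReal.ofReal t < 1 := by simpa using ht.2
        have hne : ENNReal.ofReal t ≠ 0 := by simpa using ht.1
        have hfne : {x | ENNReal.ofReal t < f x}.Nonempty :=
          (lt_iSup_iff (f := f)).1 (ht1.trans_eq hf1.symm)
        have hgne : {x | ENNReal.ofReal t < g x}.Nonempty :=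
          (lt_iSup_iff (f := g)).1 (ht1.trans_eq hg1.symm)
        refine mul_volume_add_mul_volume_le (hf measurableSet_Ioi) (hg measurableSet_Ioi)
          hfne hgne ha hb fun x hx y hy ↦ ?_
        refine lt_min (lt_of_lt_of_le ?_ (H x y)) ht1
        calc ENNReal.ofReal t = ENNReal.ofReal t ^ a * ENNReal.ofReal t ^ b := by
              rw [← ENNReal.rpow_add _ _ hne ENNReal.ofReal_ne_top, hab, ENNReal.rpow_one]
          _ < f x ^ a * g y ^ b :=
              ENNReal.mul_lt_mul (ENNReal.rpow_lt_rpow hx ha) (ENNReal.rpow_lt_rpow hy hb)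
    _ = ∫⁻ x, min (h x) 1 :=
        (lintegral_eq_lintegral_volume_lt (hh.min measurable_const) fun x ↦ min_le_right _ _).symm
    _ ≤ ∫⁻ x, h x := lintegral_mono fun x ↦ min_le_left _ _

lemma ENNReal.geom_mean_le_arith_mean2 {a b : ℝ} (ha : 0 < a) (hb : 0 < b) (hab : a + b = 1)
    (x y : ℝ≥0∞) : x ^ a * y ^ b ≤ ENNReal.ofReal a * x + ENNReal.ofReal b * y := by
  by_cases hx : x = ∞
  · subst hx; simp [ENNReal.mul_top, ha]
  by_cases hy : y = ∞
  · subst hy; simp [ENNReal.mul_top, hb]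
  lift x to NNReal using hx
  lift y to NNReal using hy
  lift a to NNReal using ha.le
  lift b to NNReal using hb.le
  have := NNReal.geom_mean_le_arith_mean2_weighted a b x y (by exact_mod_cast hab)
  rw [← ENNReal.coe_rpow_of_nonneg _ ha.le, ← ENNReal.coe_rpow_of_nonneg _ hb.le]
  simp only [ENNReal.ofReal_coe_nnreal]
  exact_mod_cast this

lemma prekopa_leindler_real_of_iSup_ne_top {f g h : ℝ → ℝ≥0∞} (hf : Measurable f)
    (hg : Measurable g) (hh : Measurable h) {a b : ℝ} (ha : 0 < a) (hb : 0 < b) (hab : a + b = 1)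
    (hf1 : ⨆ x, f x ≠ ∞) (hg1 : ⨆ x, g x ≠ ∞)
    (H : ∀ x y, f x ^ a * g y ^ b ≤ h (a * x + b * y)) :
    (∫⁻ x, f x) ^ a * (∫⁻ x, g x) ^ b ≤ ∫⁻ x, h x := by
  by_cases hf0 : ⨆ x, f x = 0
  · simp only [ENNReal.iSup_eq_zero] at hf0
    simp [hf0, ha]
  by_cases hg0 : ⨆ x, g x = 0
  · simp only [ENNReal.iSup_eq_zero] at hg0
    simp [hg0, hb]
  set A := ⨆ x, f x with hA
  set B := ⨆ x, g x with hB
  have hA' : A ^ a ≠ 0 ∧ A ^ a ≠ ∞ := by simp [hf0, hf1, ha]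
  have hB' : B ^ b ≠ 0 ∧ B ^ b ≠ ∞ := by simp [hg0, hg1, hb]
  have key := prekopa_leindler_real_of_iSup_eq_one (hf.const_mul A⁻¹) (hg.const_mul B⁻¹)
    (hh.const_mul (A ^ a * B ^ b)⁻¹) ha hb hab
    (by rw [← ENNReal.mul_iSup, ← hA, ENNReal.inv_mul_cancel hf0 hf1])
    (by rw [← ENNReal.mul_iSup, ← hB, ENNReal.inv_mul_cancel hg0 hg1])
    (fun x y ↦ by
      rw [ENNReal.mul_rpow_of_nonneg _ _ ha.le, ENNReal.mul_rpow_of_nonneg _ _ hb.le,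
        ENNReal.inv_rpow, ENNReal.inv_rpow, mul_mul_mul_comm,
        ← ENNReal.mul_inv (.inl hA'.1) (.inl hA'.2)]
      gcongr
      exact H x y)
  have key2 := (ENNReal.geom_mean_le_arith_mean2 ha hb hab _ _).trans key
  rw [lintegral_const_mul _ hf, lintegral_const_mul _ hg, lintegral_const_mul _ hh,
    ENNReal.mul_rpow_of_nonneg _ _ ha.le, ENNReal.mul_rpow_of_nonneg _ _ hb.le,
    ENNReal.inv_rpow, ENNReal.inv_rpow, mul_mul_mul_comm,
    ← ENNReal.mul_inv (.inl hA'.1) (.inl hA'.2)] at key2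
  rwa [ENNReal.mul_le_mul_iff_right] at key2
  · simp [ENNReal.mul_eq_top, hA', hB']
  · simp [hA', hB']

/-- The one-dimensional **Prékopa–Leindler inequality**. -/
lemma prekopa_leindler_real {f g h : ℝ → ℝ≥0∞} (hf : Measurable f)
    (hg : Measurable g) (hh : Measurable h) {a b : ℝ} (ha : 0 < a) (hb : 0 < b) (hab : a + b = 1)
    (H : ∀ x y, f x ^ a * g y ^ b ≤ h (a * x + b * y)) :
    (∫⁻ x, f x) ^ a * (∫⁻ x, g x) ^ b ≤ ∫⁻ x, h x := by
  have hsup : ∀ y : ℝ≥0∞, y = ⨆ k : ℕ, min y k := fun y ↦ by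
    rw [← inf_iSup_eq, ENNReal.iSup_natCast, inf_top_eq]
  have hmono : ∀ F : ℝ → ℝ≥0∞, Monotone fun (k : ℕ) x ↦ min (F x) k := fun F k l hkl x ↦ by
    dsimp only; gcongr
  have hlim : ∀ F : ℝ → ℝ≥0∞, Measurable F → ∫⁻ x, F x = ⨆ k : ℕ, ∫⁻ x, min (F x) k :=
    fun F hF ↦ by
      rw [← lintegral_iSup (fun k ↦ hF.min measurable_const) (hmono F)]
      exact lintegral_congr fun x ↦ hsup _
  rw [hlim f hf, hlim g hg]
  refine iSup_rpow_mul_iSup_rpow_le (fun k l hkl ↦ lintegral_mono (hmono f hkl))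
    (fun k l hkl ↦ lintegral_mono (hmono g hkl)) ha hb fun k ↦ ?_
  refine prekopa_leindler_real_of_iSup_ne_top (hf.min measurable_const) (hg.min measurable_const)
    hh ha hb hab ?_ ?_ fun x y ↦ le_trans ?_ (H x y)
  · exact ne_top_of_le_ne_top (ENNReal.natCast_ne_top k) (iSup_le fun x ↦ min_le_right _ _)
  · exact ne_top_of_le_ne_top (ENNReal.natCast_ne_top k) (iSup_le fun x ↦ min_le_right _ _)
  · gcongr <;> exact min_le_left _ _

/-- The **Prékopa–Leindler inequality** in `ℝⁿ`. -/
lemma prekopa_leindler (n : ℕ) {f g h : (Fin n → ℝ) → ℝ≥0∞} (hf : Measurable f)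
    (hg : Measurable g) (hh : Measurable h) {a b : ℝ} (ha : 0 < a) (hb : 0 < b) (hab : a + b = 1)
    (H : ∀ x y, f x ^ a * g y ^ b ≤ h (a • x + b • y)) :
    (∫⁻ x, f x) ^ a * (∫⁻ x, g x) ^ b ≤ ∫⁻ x, h x := by
  induction n with
  | zero =>
    have hint : ∀ F : (Fin 0 → ℝ) → ℝ≥0∞, ∫⁻ x, F x = F default := fun F ↦ by
      rw [volume_pi, Measure.pi_of_empty _ default, lintegral_dirac]
    rw [hint, hint, hint]
    exact (H _ _).trans_eq (congrArg h (Subsingleton.elim _ _))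
  | succ n ih =>
    let e := MeasurableEquiv.piFinSuccAbove (fun _ : Fin (n + 1) ↦ ℝ) 0
    have he : MeasurePreserving e.symm := (volume_preserving_piFinSuccAbove _ 0).symm
    have hint : ∀ F : (Fin (n + 1) → ℝ) → ℝ≥0∞, Measurable F →
        ∫⁻ x, F x = ∫⁻ t : ℝ, ∫⁻ x : Fin n → ℝ, F (e.symm (t, x)) := fun F hF ↦ by
      rw [← he.lintegral_comp hF, Measure.volume_eq_prod, lintegral_prod _ (by fun_prop)]
    have hmeas : ∀ F : (Fin (n + 1) → ℝ) → ℝ≥0∞, Measurable F →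
        Measurable fun t : ℝ ↦ ∫⁻ x : Fin n → ℝ, F (e.symm (t, x)) := fun F hF ↦
      Measurable.lintegral_prod_right (f := fun t x ↦ F (e.symm (t, x)))
        (show Measurable (F ∘ e.symm) by fun_prop)
    rw [hint f hf, hint g hg, hint h hh]
    refine prekopa_leindler_real (hmeas f hf) (hmeas g hg) (hmeas h hh) ha hb hab fun s t ↦ ?_
    refine ih (by fun_prop) (by fun_prop) (by fun_prop) fun x y ↦ ?_
    refine (H _ _).trans_eq (congrArg h ?_)
    ext i
    refine Fin.cases ?_ (fun j ↦ ?_) i <;> simp [e]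

/-- An interval of positive reals is separated from its complement by the sign of the difference
between a concave power function and a suitable affine function. -/
lemma exists_affine_le_rpow_on {K : Set ℝ} (hK0 : K ⊆ Set.Ioi 0) (hK : K.OrdConnected)
    {θ : ℝ} (hθ0 : 0 < θ) (hθ1 : θ < 1) :
    ∃ a b : ℝ, ∀ t, 0 < t → (t ∈ K → a + b * t ≤ t ^ θ) ∧ (t ∉ K → t ^ θ ≤ a + b * t) := by
  have young : ∀ t τ : ℝ, 0 < t → 0 < τ → t ^ θ ≤ (1 - θ) * τ ^ θ + θ * τ ^ (θ - 1) * t := by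
    intro t τ ht hτ
    have h := Real.geom_mean_le_arith_mean2_weighted hθ0.le (sub_nonneg.2 hθ1.le) ht.le hτ.le
      (by ring)
    have h2 : τ ^ (θ - 1) * τ ^ (1 - θ) = 1 := by rw [← Real.rpow_add hτ]; simp
    have h3 : τ ^ (θ - 1) * τ = τ ^ θ := by
      nth_rw 2 [← Real.rpow_one τ]; rw [← Real.rpow_add hτ]; simp
    calc t ^ θ = τ ^ (θ - 1) * (t ^ θ * τ ^ (1 - θ)) := by linear_combination -(t ^ θ) * h2
      _ ≤ τ ^ (θ - 1) * (θ * t + (1 - θ) * τ) := by gcongr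
      _ = _ := by linear_combination (1 - θ) * h3
  rcases K.eq_empty_or_nonempty with rfl | hne
  · exact ⟨_, _, fun t ht ↦ ⟨fun h ↦ h.elim, fun _ ↦ young t 1 ht one_pos⟩⟩
  have hbelow : BddBelow K := ⟨0, fun x hx ↦ (hK0 hx).le⟩
  have hu0 : 0 ≤ sInf K := Real.sInf_nonneg fun x hx ↦ (hK0 hx).le
  have hout : ∀ t, t ∉ K → sInf K < t → t ∈ upperBounds K := by
    intro t ht hut k hk
    obtain ⟨l, hl, hlt⟩ := exists_lt_of_csInf_lt hne hut
    by_contra! h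
    exact ht (hK.out hl hk ⟨hlt.le, h.le⟩)
  by_cases habove : BddAbove K
  swap
  · refine ⟨sInf K ^ θ, 0, fun t ht ↦ ⟨fun h ↦ ?_, fun h ↦ ?_⟩⟩
    · have := csInf_le hbelow h
      simp only [zero_mul, add_zero]; gcongr
    · have : t ≤ sInf K := by
        by_contra! h'
        exact habove ⟨t, hout t h h'⟩
      simp only [zero_mul, add_zero]; gcongr
  have hout' : ∀ t, t ∉ K → t ≤ sInf K ∨ sSup K ≤ t := fun t ht ↦ by
    by_contra! h
    exact absurd (csSup_le hne (hout t ht h.1)) (not_le.2 h.2)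
  have hin : ∀ t ∈ K, sInf K ≤ t ∧ t ≤ sSup K := fun t ht ↦
    ⟨csInf_le hbelow ht, le_csSup habove ht⟩
  obtain ⟨k, hk⟩ := hne
  have huv : sInf K ≤ sSup K := (hin k hk).1.trans (hin k hk).2
  have hv0 : 0 < sSup K := (hK0 hk).trans_le (hin k hk).2
  generalize sInf K = u at *
  generalize sSup K = v at *
  rcases huv.eq_or_lt with rfl | huv
  · refine ⟨_, _, fun t ht ↦ ⟨fun h ↦ ?_, fun _ ↦ young t u ht hv0⟩⟩
    obtain rfl : t = u := le_antisymm (hin t h).2 (hin t h).1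
    have h3 : t ^ (θ - 1) * t = t ^ θ := by
      nth_rw 2 [← Real.rpow_one t]; rw [← Real.rpow_add ht]; simp
    exact le_of_eq (by linear_combination θ * h3)
  have hconc := Real.concaveOn_rpow hθ0.le hθ1.le
  have huv' : 0 < v - u := sub_pos.2 huv
  refine ⟨u ^ θ - (v ^ θ - u ^ θ) / (v - u) * u, (v ^ θ - u ^ θ) / (v - u), fun t ht ↦ ?_⟩
  have hsec : ∀ x y, 0 ≤ x → 0 ≤ y → x ≠ u → y ≠ u → x ≤ y →
      (y ^ θ - u ^ θ) / (y - u) ≤ (x ^ θ - u ^ θ) / (x - u) :=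
    fun x y hx hy hxu hyu hxy ↦ by
      have h := hconc.neg.secant_mono hu0 hx hy hxu hyu hxy
      simp only [Pi.neg_apply] at h
      rw [← neg_le_neg_iff, ← neg_div, ← neg_div]
      simpa only [neg_sub_neg, neg_sub] using h
  constructor
  · intro h
    rcases (hin t h).1.eq_or_lt with rfl | hut
    · simp
    have := hsec t v ht.le hv0.le hut.ne' huv.ne' (hin t h).2
    rw [le_div_iff₀ (sub_pos.2 hut)] at this
    linarith
  · intro h
    rcases lt_trichotomy t u with htu | rfl | hut
    · have := hsec t v ht.le hv0.le htu.ne huv.ne' (htu.trans huv).le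
      rw [le_div_iff_of_neg (sub_neg.2 htu)] at this
      linarith
    · simp
    · have := hsec v t hv0.le ht.le huv.ne' hut.ne' ((hout' t h).resolve_left (not_le.2 hut))
      rw [div_le_iff₀ (sub_pos.2 hut)] at this
      linarith

lemma integrableOn_rpow_mul_exp_neg_mul {p c : ℝ} (hp : 0 < p) (hc : 0 < c) :
    IntegrableOn (fun s : ℝ ↦ s ^ (p - 1) * Real.exp (-(c * s))) (Set.Ioi 0) := by
  simpa using integrableOn_rpow_mul_exp_neg_mul_rpow (s := p - 1) (p := 1) (by linarith) one_pos hc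

/-- **Borell lemma**: normalised moments of a log-concave function on the half-line are
log-concave in the exponent. -/
lemma borell_of_integrable {H : ℝ → ℝ} (hH0 : ∀ s, 0 ≤ H s)
    (hH : ∀ x y l m : ℝ, 0 < x → 0 < y → 0 < l → 0 < m → l + m = 1 →
      H x ^ l * H y ^ m ≤ H (l * x + m * y))
    {p q r a b : ℝ} (hp : 0 < p) (hpr : p < r) (ha : 0 < a) (hb : 0 < b) (hab : a + b = 1)
    (hq : q = a * p + b * r)
    (hip : IntegrableOn (fun s ↦ s ^ (p - 1) * H s) (Set.Ioi 0))
    (hiq : IntegrableOn (fun s ↦ s ^ (q - 1) * H s) (Set.Ioi 0))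
    (hir : IntegrableOn (fun s ↦ s ^ (r - 1) * H s) (Set.Ioi 0))
    (hMp : 0 < ∫ s in Set.Ioi 0, s ^ (p - 1) * H s)
    (hMr : 0 < ∫ s in Set.Ioi 0, s ^ (r - 1) * H s) :
    ((∫ s in Set.Ioi 0, s ^ (p - 1) * H s) / Real.Gamma p) ^ a *
      ((∫ s in Set.Ioi 0, s ^ (r - 1) * H s) / Real.Gamma r) ^ b ≤
      (∫ s in Set.Ioi 0, s ^ (q - 1) * H s) / Real.Gamma q := by
  have hr : 0 < r := hp.trans hpr
  have hq0 : 0 < q := by rw [hq]; positivity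
  have hrp : 0 < r - p := sub_pos.2 hpr
  have hP : 0 < (∫ s in Set.Ioi 0, s ^ (p - 1) * H s) / Real.Gamma p :=
    div_pos hMp (Real.Gamma_pos_of_pos hp)
  have hR : 0 < (∫ s in Set.Ioi 0, s ^ (r - 1) * H s) / Real.Gamma r :=
    div_pos hMr (Real.Gamma_pos_of_pos hr)
  set P := (∫ s in Set.Ioi 0, s ^ (p - 1) * H s) / Real.Gamma p with hPdef
  set R := (∫ s in Set.Ioi 0, s ^ (r - 1) * H s) / Real.Gamma r with hRdef
  obtain ⟨c, A, hc, hA, hAp, hAr⟩ : ∃ c A : ℝ, 0 < c ∧ 0 < A ∧ A * (1 / c) ^ p = P ∧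
      A * (1 / c) ^ r = R := by
    obtain ⟨c, hc, hcPR⟩ : ∃ c : ℝ, 0 < c ∧ c ^ (r - p) = P / R :=
      ⟨(P / R) ^ (r - p)⁻¹, by positivity, Real.rpow_inv_rpow (by positivity) hrp.ne'⟩
    refine ⟨c, P * c ^ p, hc, by positivity, ?_, ?_⟩
    · rw [one_div, Real.inv_rpow hc.le, mul_inv_cancel_right₀ (by positivity)]
    · rw [Real.rpow_sub hc, div_eq_div_iff (by positivity) hR.ne'] at hcPR
      rw [one_div, Real.inv_rpow hc.le, ← div_eq_mul_inv, div_eq_iff (by positivity)]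
      linarith
  have hmean : P ^ a * R ^ b = A * (1 / c) ^ q := by
    rw [← hAp, ← hAr, Real.mul_rpow hA.le (by positivity), Real.mul_rpow hA.le (by positivity),
      mul_mul_mul_comm, ← Real.rpow_add hA, hab, Real.rpow_one, ← Real.rpow_mul (by positivity),
      ← Real.rpow_mul (by positivity), ← Real.rpow_add (by positivity), hq]
    ring_nf
  set E : ℝ → ℝ := fun s ↦ A * Real.exp (-(c * s)) with hE
  have hE0 : ∀ s, 0 < E s := fun s ↦ mul_pos hA (Real.exp_pos _)
  have hE_int : ∀ z : ℝ, 0 < z → IntegrableOn (fun s : ℝ ↦ s ^ (z - 1) * E s) (Set.Ioi 0) := fun z hz ↦ by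
    refine ((integrableOn_rpow_mul_exp_neg_mul hz hc).const_mul A).congr (.of_forall fun s ↦ ?_)
    simp only [hE]; ring
  have hE_val : ∀ z, 0 < z →
      ∫ s in Set.Ioi 0, s ^ (z - 1) * E s = A * (1 / c) ^ z * Real.Gamma z := fun z hz ↦ by
    rw [mul_assoc, ← Real.integral_rpow_mul_exp_neg_mul_Ioi hz hc, ← integral_const_mul]
    congr 1; ext s; simp only [hE]; ring
  have hE_geom : ∀ x y l m : ℝ, l + m = 1 → E x ^ l * E y ^ m = E (l * x + m * y) := by
    intro x y l m hlm
    simp only [hE]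
    rw [Real.mul_rpow hA.le (Real.exp_nonneg _), Real.mul_rpow hA.le (Real.exp_nonneg _),
      mul_mul_mul_comm, ← Real.rpow_add hA, hlm, Real.rpow_one, ← Real.exp_mul, ← Real.exp_mul,
      ← Real.exp_add]
    ring_nf
  have hK : {s | 0 < s ∧ E s ≤ H s}.OrdConnected := by
    refine Set.ordConnected_iff.2 fun x hx y hy hxy z hz ↦ ⟨hx.1.trans_le hz.1, ?_⟩
    rcases hz.1.eq_or_lt with rfl | hxz
    · exact hx.2
    rcases hz.2.eq_or_lt with rfl | hzy
    · exact hy.2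
    have hyx : 0 < y - x := by linarith
    have hl : 0 < (y - z) / (y - x) := div_pos (by linarith) hyx
    have hm : 0 < (z - x) / (y - x) := div_pos (by linarith) hyx
    have hlm : (y - z) / (y - x) + (z - x) / (y - x) = 1 := by field_simp; ring
    have hzz : (y - z) / (y - x) * x + (z - x) / (y - x) * y = z := by field_simp; ring
    have h := hH x y _ _ hx.1 hy.1 hl hm hlm
    have h' := hE_geom x y _ _ hlm
    rw [hzz] at h h'
    rw [← h']
    refine le_trans ?_ h
    exact mul_le_mul (Real.rpow_le_rpow (hE0 x).le hx.2 hl.le)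
      (Real.rpow_le_rpow (hE0 y).le hy.2 hm.le) (Real.rpow_nonneg (hE0 y).le _)
      (Real.rpow_nonneg (hH0 x) _)
  obtain ⟨a', b', hw⟩ := exists_affine_le_rpow_on
    (K := {t | 0 < t ∧ t ^ (1 / (r - p)) ∈ {s | 0 < s ∧ E s ≤ H s}}) (fun t ht ↦ ht.1)
    (Set.ordConnected_iff.2 fun x hx y hy hxy z hz ↦ ⟨hx.1.trans_le hz.1, hK.out hx.2 hy.2
      ⟨Real.rpow_le_rpow hx.1.le hz.1 (by positivity),
        Real.rpow_le_rpow (hx.1.trans_le hz.1).le hz.2 (by positivity)⟩⟩)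
    hb (by linarith)
  have hpt : ∀ s ∈ Set.Ioi (0 : ℝ), 0 ≤ (s ^ (q - 1) * H s - s ^ (q - 1) * E s)
      - a' * (s ^ (p - 1) * H s - s ^ (p - 1) * E s)
      - b' * (s ^ (r - 1) * H s - s ^ (r - 1) * E s) := by
    intro s hs
    have hs : 0 < s := hs
    have h1 : s ^ (q - 1) = s ^ (p - 1) * (s ^ (r - p)) ^ b := by
      rw [← Real.rpow_mul hs.le, ← Real.rpow_add hs, hq]
      congr 1; linear_combination (p : ℝ) * hab
    have h2 : s ^ (r - 1) = s ^ (p - 1) * s ^ (r - p) := by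
      rw [← Real.rpow_add hs]; ring_nf
    have h3 : (s ^ (r - p)) ^ (1 / (r - p)) = s := by
      rw [← Real.rpow_mul hs.le]; field_simp; simp
    have h4 : 0 < s ^ (p - 1) := by positivity
    obtain ⟨hin, hout⟩ := hw (s ^ (r - p)) (by positivity)
    have h0 : 0 < s ^ (r - p) := by positivity
    simp only [Set.mem_ofPred_eq, h3, hs, h0, true_and] at hin hout
    have : 0 ≤ ((s ^ (r - p)) ^ b - (a' + b' * s ^ (r - p))) * (H s - E s) := by
      by_cases h : E s ≤ H s
      · exact mul_nonneg (sub_nonneg.2 (hin h)) (sub_nonneg.2 h)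
      · exact mul_nonneg_of_nonpos_of_nonpos (sub_nonpos.2 (hout h))
          (sub_nonpos.2 (not_le.1 h).le)
    rw [h1, h2]
    have := mul_nonneg h4.le this
    linarith
  have hint := setIntegral_nonneg (μ := volume) measurableSet_Ioi hpt
  rw [integral_sub, integral_sub, integral_const_mul, integral_const_mul, integral_sub hip
    (hE_int p hp), integral_sub hiq (hE_int q hq0), integral_sub hir (hE_int r hr), hE_val p hp,
    hE_val q hq0, hE_val r hr, hAp, hAr, hPdef, hRdef,
    div_mul_cancel₀ _ (Real.Gamma_pos_of_pos hp).ne',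
    div_mul_cancel₀ _ (Real.Gamma_pos_of_pos hr).ne'] at hint
  · rw [hmean, le_div_iff₀ (Real.Gamma_pos_of_pos hq0)]
    linarith
  · exact hiq.sub (hE_int q hq0)
  · exact (hip.sub (hE_int p hp)).const_mul _
  · exact (hiq.sub (hE_int q hq0)).sub ((hip.sub (hE_int p hp)).const_mul _)
  · exact (hir.sub (hE_int r hr)).const_mul _

/-- **Borell lemma** for `ℝ≥0∞`-valued moments. -/
lemma borell_lintegral {H : ℝ → ℝ≥0∞} (hHm : Measurable H) (hHfin : ∀ s, 0 < s → H s ≠ ∞)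
    (hH : ∀ x y l m : ℝ, 0 < x → 0 < y → 0 < l → 0 < m → l + m = 1 →
      H x ^ l * H y ^ m ≤ H (l * x + m * y))
    {p q r a b : ℝ} (hp : 0 < p) (hpr : p < r) (ha : 0 < a) (hb : 0 < b) (hab : a + b = 1)
    (hq : q = a * p + b * r) :
    ((∫⁻ s in Set.Ioi 0, ENNReal.ofReal (s ^ (p - 1)) * H s) / ENNReal.ofReal (Real.Gamma p)) ^ a *
      ((∫⁻ s in Set.Ioi 0, ENNReal.ofReal (s ^ (r - 1)) * H s) /
        ENNReal.ofReal (Real.Gamma r)) ^ b ≤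
      (∫⁻ s in Set.Ioi 0, ENNReal.ofReal (s ^ (q - 1)) * H s) / ENNReal.ofReal (Real.Gamma q) := by
  have hr : 0 < r := hp.trans hpr
  have hq0 : 0 < q := by rw [hq]; positivity
  have hΓ : ∀ z, 0 < z → 0 < Real.Gamma z := fun z hz ↦ Real.Gamma_pos_of_pos hz
  by_cases htop : ∫⁻ s in Set.Ioi 0, ENNReal.ofReal (s ^ (q - 1)) * H s = ∞
  · rw [htop, ENNReal.top_div_of_ne_top ENNReal.ofReal_ne_top]; exact le_top
  let T : ℕ → Set ℝ := fun k ↦ Set.Icc (1 / ((k : ℝ) + 1)) ((k : ℝ) + 1)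
  have hTpos : ∀ k, ∀ s ∈ T k, 0 < s := fun k s hs ↦ lt_of_lt_of_le (by positivity) hs.1
  have hTm : ∀ k, MeasurableSet (T k) := fun k ↦ measurableSet_Icc
  have hTmono : Monotone T := fun k l hkl ↦ by
    have : (k : ℝ) ≤ l := by exact_mod_cast hkl
    exact Set.Icc_subset_Icc (by gcongr) (by gcongr)
  have hTU : ⋃ k, T k = Set.Ioi 0 := by
    ext s
    simp only [Set.mem_iUnion, Set.mem_Ioi]
    refine ⟨fun ⟨k, hk⟩ ↦ hTpos k s hk, fun hs ↦ ?_⟩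
    obtain ⟨k, hk⟩ := exists_nat_ge (max s (1 / s))
    refine ⟨k, ?_, ?_⟩
    · rw [div_le_iff₀ (by positivity)]
      have := (le_max_right _ _).trans hk
      rw [div_le_iff₀ hs] at this
      nlinarith
    · have := (le_max_left _ _).trans hk
      linarith
  let M : ℝ → ℕ → ℝ≥0∞ := fun z k ↦ ∫⁻ s in T k, ENNReal.ofReal (s ^ (z - 1)) * H s
  have hM : ∀ z, ∫⁻ s in Set.Ioi 0, ENNReal.ofReal (s ^ (z - 1)) * H s = ⨆ k, M z k := fun z ↦ by
    rw [← hTU, setLIntegral_iUnion_of_directed _ hTmono.directed_le]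
  have hMmono : ∀ z, Monotone (M z) := fun z k l hkl ↦ lintegral_mono_set (hTmono hkl)
  have hMq : ∀ k, M q k ≠ ∞ := fun k ↦
    ne_top_of_le_ne_top htop ((le_iSup (M q) k).trans_eq (hM q).symm)
  have hMz : ∀ z k, M z k ≠ ∞ := fun z k ↦ by
    obtain ⟨C, hC⟩ := (isCompact_Icc (a := 1 / ((k : ℝ) + 1)) (b := (k : ℝ) + 1)).bddAbove_image
      (f := fun s : ℝ ↦ s ^ (z - q))
      (continuousOn_id.rpow_const fun s hs ↦ .inl (hTpos k s hs).ne')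
    refine ne_top_of_le_ne_top (ENNReal.mul_ne_top (ENNReal.ofReal_ne_top (r := C)) (hMq k)) ?_
    simp only [M]
    rw [← lintegral_const_mul _ (by fun_prop)]
    refine setLIntegral_mono (by fun_prop) fun s hs ↦ ?_
    have hs0 := hTpos k s hs
    have h1 : s ^ (z - 1) = s ^ (z - q) * s ^ (q - 1) := by
      rw [← Real.rpow_add hs0]; ring_nf
    have h2 : s ^ (z - q) ≤ C := hC ⟨s, hs, rfl⟩
    rw [h1, ENNReal.ofReal_mul (by positivity), mul_assoc]
    gcongr
  let F : ℕ → ℝ → ℝ := fun k ↦ (T k).indicator fun s ↦ (H s).toReal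
  have hF0 : ∀ k s, 0 ≤ F k s := fun k s ↦
    Set.indicator_nonneg (fun s _ ↦ ENNReal.toReal_nonneg) s
  have hFint : ∀ z k, ∫⁻ s in Set.Ioi 0, ENNReal.ofReal (s ^ (z - 1) * F k s) = M z k := by
    intro z k
    have : ∀ s ∈ Set.Ioi (0 : ℝ), ENNReal.ofReal (s ^ (z - 1) * F k s) =
        (T k).indicator (fun s ↦ ENNReal.ofReal (s ^ (z - 1)) * H s) s := fun s hs ↦ by
      by_cases h : s ∈ T k
      · simp only [F, Set.indicator_of_mem h]
        rw [ENNReal.ofReal_mul (Real.rpow_nonneg (le_of_lt hs) _),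
          ENNReal.ofReal_toReal (hHfin s hs)]
      · simp [F, Set.indicator_of_notMem h]
    rw [setLIntegral_congr_fun measurableSet_Ioi this, lintegral_indicator (hTm k),
      Measure.restrict_restrict (hTm k), Set.inter_eq_left.2 (show T k ⊆ Set.Ioi 0 from hTpos k)]
  have hFm : ∀ k, Measurable (F k) := fun k ↦ hHm.ennreal_toReal.indicator (hTm k)
  have hFnn : ∀ (z : ℝ) k, 0 ≤ᵐ[volume.restrict (Set.Ioi 0)] fun s : ℝ ↦ s ^ (z - 1) * F k s :=
    fun z k ↦ (ae_restrict_iff' measurableSet_Ioi).2 (.of_forall fun s hs ↦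
      mul_nonneg (Real.rpow_nonneg (le_of_lt (Set.mem_Ioi.1 hs)) _) (hF0 k s))
  have hFi : ∀ (z : ℝ) k, IntegrableOn (fun s ↦ s ^ (z - 1) * F k s) (Set.Ioi 0) := fun z k ↦ by
    have hm := hFm k
    refine ⟨by fun_prop, ?_⟩
    rw [hasFiniteIntegral_iff_ofReal (hFnn z k), hFint]
    exact (hMz z k).lt_top
  have hFval : ∀ (z : ℝ) k, ∫ s in Set.Ioi 0, s ^ (z - 1) * F k s = (M z k).toReal := fun z k ↦ by
    rw [integral_eq_lintegral_of_nonneg_ae (hFnn z k) (hFi z k).aestronglyMeasurable, hFint]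
  have hFconc : ∀ k, ∀ x y l m : ℝ, 0 < x → 0 < y → 0 < l → 0 < m → l + m = 1 →
      F k x ^ l * F k y ^ m ≤ F k (l * x + m * y) := by
    intro k x y l m hx hy hl hm hlm
    by_cases hxT : x ∈ T k
    swap
    · simp only [F, Set.indicator_of_notMem hxT, Real.zero_rpow hl.ne', zero_mul]
      exact hF0 k _
    by_cases hyT : y ∈ T k
    swap
    · simp only [F, Set.indicator_of_notMem hyT, Real.zero_rpow hm.ne', mul_zero]
      exact hF0 k _
    have hzT : l * x + m * y ∈ T k := convex_Icc _ _ hxT hyT hl.le hm.le hlm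
    simp only [F, Set.indicator_of_mem hxT, Set.indicator_of_mem hyT, Set.indicator_of_mem hzT]
    rw [ENNReal.toReal_rpow, ENNReal.toReal_rpow, ← ENNReal.toReal_mul]
    exact ENNReal.toReal_mono (hHfin _ (by positivity)) (hH x y l m hx hy hl hm hlm)
  simp only [hM, ENNReal.iSup_div]
  refine iSup_rpow_mul_iSup_rpow_le (fun k l hkl ↦ ENNReal.div_le_div_right (hMmono p hkl) _)
    (fun k l hkl ↦ ENNReal.div_le_div_right (hMmono r hkl) _) ha hb fun k ↦ ?_
  refine le_trans ?_ (le_iSup (fun k ↦ M q k / ENNReal.ofReal (Real.Gamma q)) k)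
  by_cases hp0 : M p k = 0
  · simp [hp0, ha]
  by_cases hr0 : M r k = 0
  · simp [hr0, hb]
  have key := borell_of_integrable (hF0 k) (hFconc k) hp hpr ha hb hab hq (hFi p k) (hFi q k)
    (hFi r k) (by rw [hFval]; exact ENNReal.toReal_pos hp0 (hMz p k))
    (by rw [hFval]; exact ENNReal.toReal_pos hr0 (hMz r k))
  rw [hFval, hFval, hFval] at key
  have key' := ENNReal.ofReal_le_ofReal key
  have hofReal : ∀ z, 0 < z → ENNReal.ofReal ((M z k).toReal / Real.Gamma z) =
      M z k / ENNReal.ofReal (Real.Gamma z) := fun z hz ↦ by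
    rw [ENNReal.ofReal_div_of_pos (hΓ z hz), ENNReal.ofReal_toReal (hMz z k)]
  have hnn : ∀ z, 0 < z → 0 ≤ (M z k).toReal / Real.Gamma z := fun z hz ↦
    div_nonneg ENNReal.toReal_nonneg (hΓ z hz).le
  rwa [ENNReal.ofReal_mul (Real.rpow_nonneg (hnn p hp) _),
    ← ENNReal.ofReal_rpow_of_nonneg (hnn p hp) ha.le,
    ← ENNReal.ofReal_rpow_of_nonneg (hnn r hr) hb.le, hofReal p hp, hofReal q hq0,
    hofReal r hr] at key'

section Laplace

variable {n : ℕ} {S : Set (Fin n → ℝ)} {φ : (Fin n → ℝ) → ℝ}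

lemma measurable_lintegral_exp_neg_mul (hφm : Measurable φ) :
    Measurable fun s : ℝ ↦ ∫⁻ x in S, ENNReal.ofReal (Real.exp (-(s * φ x))) :=
  Measurable.lintegral_prod_right' (ν := volume.restrict S)
    (f := fun z : ℝ × (Fin n → ℝ) ↦ ENNReal.ofReal (Real.exp (-(z.1 * φ z.2)))) (by fun_prop)

lemma Gamma_mul_lintegral_rpow_neg (hS : MeasurableSet S) (hφm : Measurable φ)
    (hφ0 : ∀ x ∈ S, 0 < φ x) {p : ℝ} (hp : 0 < p) :
    ENNReal.ofReal (Real.Gamma p) * ∫⁻ x in S, ENNReal.ofReal (φ x ^ (-p)) =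
      ∫⁻ s in Set.Ioi 0, ENNReal.ofReal (s ^ (p - 1)) *
        ∫⁻ x in S, ENNReal.ofReal (Real.exp (-(s * φ x))) := by
  calc ENNReal.ofReal (Real.Gamma p) * ∫⁻ x in S, ENNReal.ofReal (φ x ^ (-p))
      = ∫⁻ x in S, ∫⁻ s in Set.Ioi (0 : ℝ),
          ENNReal.ofReal (s ^ (p - 1)) * ENNReal.ofReal (Real.exp (-(s * φ x))) := by
        rw [← lintegral_const_mul _ (by fun_prop)]
        refine setLIntegral_congr_fun hS fun x hx ↦ ?_
        have hx0 := hφ0 x hx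
        have hnn : ∀ s ∈ Set.Ioi (0 : ℝ), 0 ≤ s ^ (p - 1) := fun s hs ↦
          Real.rpow_nonneg (le_of_lt hs) _
        have hval := Real.integral_rpow_mul_exp_neg_mul_Ioi hp hx0
        rw [integral_eq_lintegral_of_nonneg_ae ((ae_restrict_iff' measurableSet_Ioi).2
          (.of_forall fun s hs ↦ mul_nonneg (hnn s hs) (Real.exp_nonneg _)))
          (integrableOn_rpow_mul_exp_neg_mul hp hx0).aestronglyMeasurable] at hval
        have hfin := (integrableOn_rpow_mul_exp_neg_mul hp hx0).lintegral_lt_top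
        rw [← ENNReal.ofReal_mul (Real.Gamma_pos_of_pos hp).le, Real.rpow_neg hx0.le,
          ← Real.inv_rpow hx0.le, ← one_div, mul_comm, ← hval, ENNReal.ofReal_toReal hfin.ne]
        refine setLIntegral_congr_fun measurableSet_Ioi fun s hs ↦ ?_
        rw [ENNReal.ofReal_mul (hnn s hs), mul_comm (φ x)]
    _ = ∫⁻ s in Set.Ioi (0 : ℝ), ∫⁻ x in S,
          ENNReal.ofReal (s ^ (p - 1)) * ENNReal.ofReal (Real.exp (-(s * φ x))) :=
        lintegral_lintegral_swap (Measurable.aemeasurable (by fun_prop))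
    _ = _ := by
        refine lintegral_congr fun s ↦ ?_
        rw [lintegral_const_mul _ (by fun_prop)]

lemma lintegral_comp_inv_smul {F : (Fin n → ℝ) → ℝ≥0∞} (hF : Measurable F) {s : ℝ} (hs : 0 < s) :
    ∫⁻ x, F (s⁻¹ • x) = ENNReal.ofReal (s ^ n) * ∫⁻ x, F x := by
  rw [← lintegral_map hF (measurable_const_smul s⁻¹),
    Measure.map_addHaar_smul volume (inv_ne_zero hs.ne'), lintegral_smul_measure]
  simp [abs_of_pos hs]

lemma lintegral_exp_neg_mul_ne_top (hS : MeasurableSet S) (hφm : Measurable φ)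
    (hφ0 : ∀ x ∈ S, 0 < φ x) {β : ℝ} (hβ : 0 < β)
    (hI : ∫⁻ x in S, ENNReal.ofReal (φ x ^ (-β)) ≠ ∞) {s : ℝ} (hs : 0 < s) :
    ∫⁻ x in S, ENNReal.ofReal (Real.exp (-(s * φ x))) ≠ ∞ := by
  have hWm := measurable_lintegral_exp_neg_mul (S := S) hφm
  have hfin : ∫⁻ s in Set.Ioi 0, ENNReal.ofReal (s ^ (β - 1)) *
      ∫⁻ x in S, ENNReal.ofReal (Real.exp (-(s * φ x))) ≠ ∞ := by
    rw [← Gamma_mul_lintegral_rpow_neg hS hφm hφ0 hβ]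
    exact ENNReal.mul_ne_top ENNReal.ofReal_ne_top hI
  have hae := ae_lt_top (by fun_prop) hfin
  have hae' := ae_restrict_of_ae_restrict_of_subset
    (show Set.Ioo 0 s ⊆ Set.Ioi 0 from fun t ht ↦ ht.1) hae
  have : NeZero (volume.restrict (Set.Ioo 0 s)) := ⟨by simp [hs]⟩
  obtain ⟨t, ht, htmem⟩ := (hae'.and (ae_restrict_mem measurableSet_Ioo)).exists
  have ht0 : ENNReal.ofReal (t ^ (β - 1)) ≠ 0 := by
    simpa using Real.rpow_pos_of_pos htmem.1 _
  have hWt : ∫⁻ x in S, ENNReal.ofReal (Real.exp (-(t * φ x))) ≠ ∞ := fun h ↦ by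
    simp [h, ENNReal.mul_top ht0] at ht
  refine ne_top_of_le_ne_top hWt (setLIntegral_mono (by fun_prop) fun x hx ↦ ?_)
  have := hφ0 x hx
  have := htmem.2
  gcongr

/-- The Laplace-type integral of a convex function, rescaled, is log-concave. -/
lemma logconcave_pow_mul_lintegral_exp (hS : MeasurableSet S) (hφm : Measurable φ)
    (hφ : ConvexOn ℝ S φ) (x y l m : ℝ) (hx : 0 < x) (hy : 0 < y) (hl : 0 < l) (hm : 0 < m)
    (hlm : l + m = 1) :
    (ENNReal.ofReal (x ^ n) * ∫⁻ z in S, ENNReal.ofReal (Real.exp (-(x * φ z)))) ^ l *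
      (ENNReal.ofReal (y ^ n) * ∫⁻ z in S, ENNReal.ofReal (Real.exp (-(y * φ z)))) ^ m ≤
      ENNReal.ofReal ((l * x + m * y) ^ n) *
        ∫⁻ z in S, ENNReal.ofReal (Real.exp (-((l * x + m * y) * φ z))) := by
  let F : ℝ → (Fin n → ℝ) → ℝ≥0∞ := fun s ↦ S.indicator fun z ↦ ENNReal.ofReal (Real.exp (-(s * φ z)))
  have hF : ∀ s, Measurable (F s) := fun s ↦ Measurable.indicator (by fun_prop) hS
  have hval : ∀ s, 0 < s → ENNReal.ofReal (s ^ n) * ∫⁻ z in S, ENNReal.ofReal (Real.exp (-(s * φ z)))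
      = ∫⁻ z, F s (s⁻¹ • z) := fun s hs ↦ by
    rw [lintegral_comp_inv_smul (hF s) hs, lintegral_indicator hS]
  have hz : 0 < l * x + m * y := by positivity
  rw [hval x hx, hval y hy, hval _ hz]
  refine prekopa_leindler n ((hF x).comp (measurable_const_smul _))
    ((hF y).comp (measurable_const_smul _)) ((hF _).comp (measurable_const_smul _)) hl hm hlm
    fun u v ↦ ?_
  by_cases hu : x⁻¹ • u ∈ S
  swap
  · simp [F, hu, hl]
  by_cases hv : y⁻¹ • v ∈ S
  swap
  · simp [F, hv, hm]
  set z := l * x + m * y with hzdef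
  have hcomb : z⁻¹ • (l • u + m • v) = (l * x / z) • x⁻¹ • u + (m * y / z) • y⁻¹ • v := by
    simp only [smul_add, smul_smul]
    congr 2 <;> field_simp
  have h1 : 0 ≤ l * x / z := by positivity
  have h2 : 0 ≤ m * y / z := by positivity
  have h3 : l * x / z + m * y / z = 1 := by rw [← add_div, ← hzdef, div_self hz.ne']
  have hw : z⁻¹ • (l • u + m • v) ∈ S := hcomb ▸ hφ.1 hu hv h1 h2 h3
  have hconv := hφ.2 hu hv h1 h2 h3
  rw [← hcomb] at hconv
  simp only [F, Function.comp_apply, Set.indicator_of_mem hu, Set.indicator_of_mem hv, Set.indicator_of_mem hw]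
  rw [ENNReal.ofReal_rpow_of_nonneg (Real.exp_nonneg _) hl.le,
    ENNReal.ofReal_rpow_of_nonneg (Real.exp_nonneg _) hm.le,
    ← ENNReal.ofReal_mul (by positivity), ← Real.exp_mul, ← Real.exp_mul, ← Real.exp_add]
  refine ENNReal.ofReal_le_ofReal (Real.exp_le_exp.2 ?_)
  have := mul_le_mul_of_nonneg_left hconv hz.le
  have h4 : z * ((l * x / z) • φ (x⁻¹ • u) + (m * y / z) • φ (y⁻¹ • v)) =
      l * x * φ (x⁻¹ • u) + m * y * φ (y⁻¹ • v) := by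
    simp only [smul_eq_mul]; field_simp
  linarith

lemma Gamma_eq_prod_mul_Gamma (n : ℕ) {p : ℝ} (hp : (n : ℝ) < p) :
    Real.Gamma p = (∏ i ∈ Finset.Icc 1 n, (p - (i : ℝ))) * Real.Gamma (p - n) := by
  induction n with
  | zero => simp
  | succ k ih =>
    push_cast at hp ⊢
    rw [ih (by linarith), Finset.prod_Icc_succ_top (by omega), mul_assoc]
    have h := Real.Gamma_add_one (s := p - (k + 1)) (by linarith)
    rw [show p - (k + 1) + 1 = p - k by ring] at h
    rw [h]
    push_cast
    rfl

/-- For `φ` convex and positive, `p ↦ (p - 1) ⋯ (p - n) ∫ φ⁻ᵖ` is log-concave on `(n, ∞)`. -/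
lemma logconcave_prod_mul_lintegral_rpow_neg (hS : MeasurableSet S) (hφm : Measurable φ)
    (hφ : ConvexOn ℝ S φ) (hφ0 : ∀ x ∈ S, 0 < φ x) {β : ℝ} (hβ : 0 < β)
    (hI : ∫⁻ x in S, ENNReal.ofReal (φ x ^ (-β)) ≠ ∞)
    {p r a b : ℝ} (hp : (n : ℝ) < p) (hpr : p < r) (ha : 0 < a) (hb : 0 < b) (hab : a + b = 1) :
    (ENNReal.ofReal (∏ i ∈ Finset.Icc 1 n, (p - (i : ℝ))) *
        ∫⁻ x in S, ENNReal.ofReal (φ x ^ (-p))) ^ a *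
      (ENNReal.ofReal (∏ i ∈ Finset.Icc 1 n, (r - (i : ℝ))) *
        ∫⁻ x in S, ENNReal.ofReal (φ x ^ (-r))) ^ b ≤
      ENNReal.ofReal (∏ i ∈ Finset.Icc 1 n, (a * p + b * r - (i : ℝ))) *
        ∫⁻ x in S, ENNReal.ofReal (φ x ^ (-(a * p + b * r))) := by
  have hmom : ∀ z : ℝ, (n : ℝ) < z →
      (∫⁻ s in Set.Ioi 0, ENNReal.ofReal (s ^ (z - n - 1)) * (ENNReal.ofReal (s ^ n) *
        ∫⁻ x in S, ENNReal.ofReal (Real.exp (-(s * φ x))))) / ENNReal.ofReal (Real.Gamma (z - n)) =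
      ENNReal.ofReal (∏ i ∈ Finset.Icc 1 n, (z - (i : ℝ))) *
        ∫⁻ x in S, ENNReal.ofReal (φ x ^ (-z)) := by
    intro z hz
    have hΓ : 0 < Real.Gamma (z - n) := Real.Gamma_pos_of_pos (by linarith)
    have hz0 : 0 < z := lt_of_le_of_lt (by positivity) hz
    symm
    rw [ENNReal.eq_div_iff (by simpa using hΓ) ENNReal.ofReal_ne_top, ← mul_assoc,
      ← ENNReal.ofReal_mul hΓ.le, mul_comm (Real.Gamma _), ← Gamma_eq_prod_mul_Gamma n hz,
      Gamma_mul_lintegral_rpow_neg hS hφm hφ0 hz0]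
    refine setLIntegral_congr_fun measurableSet_Ioi fun s hs ↦ ?_
    have hs : 0 < s := hs
    rw [← mul_assoc (ENNReal.ofReal (s ^ (z - n - 1))), ← ENNReal.ofReal_mul (by positivity), ← Real.rpow_natCast s n,
      ← Real.rpow_add hs]
    ring_nf
  have hq : (n : ℝ) < a * p + b * r := by nlinarith
  rw [← hmom p hp, ← hmom r (hp.trans hpr), ← hmom _ hq]
  have hWm := measurable_lintegral_exp_neg_mul (S := S) hφm
  exact borell_lintegral (by fun_prop)
    (fun s hs ↦ ENNReal.mul_ne_top ENNReal.ofReal_ne_top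
      (lintegral_exp_neg_mul_ne_top hS hφm hφ0 hβ hI hs))
    (logconcave_pow_mul_lintegral_exp hS hφm hφ) (sub_pos.2 hp) (by linarith) ha hb hab
    (by linear_combination (n : ℝ) * hab)

lemma prod_sub_pos {p : ℝ} (hp : (n : ℝ) < p) : 0 < ∏ i ∈ Finset.Icc 1 n, (p - (i : ℝ)) :=
  Finset.prod_pos fun i hi ↦ sub_pos.2
    (lt_of_le_of_lt (by exact_mod_cast (Finset.mem_Icc.1 hi).2) hp)

lemma lintegral_rpow_neg_ne_zero (hφm : Measurable φ) (hφ0 : ∀ x ∈ S, 0 < φ x)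
    (hS0 : volume S ≠ 0) (p : ℝ) :
    ∫⁻ x in S, ENNReal.ofReal (φ x ^ (-p)) ≠ 0 := by
  rw [← pos_iff_ne_zero, setLIntegral_pos_iff (by fun_prop)]
  refine lt_of_lt_of_le (pos_iff_ne_zero.2 hS0) (measure_mono fun x hx ↦ ⟨?_, hx⟩)
  simpa using Real.rpow_pos_of_pos (hφ0 x hx) _

lemma lintegral_rpow_neg_ne_top (hS : MeasurableSet S) (hS0 : volume S ≠ 0) (hφm : Measurable φ)
    (hφ : ConvexOn ℝ S φ) (hφ0 : ∀ x ∈ S, 0 < φ x) {β : ℝ} (hβ : (n : ℝ) < β)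
    (hI : ∫⁻ x in S, ENNReal.ofReal (φ x ^ (-β)) ≠ ∞) {p : ℝ} (hp : (n : ℝ) < p) :
    ∫⁻ x in S, ENNReal.ofReal (φ x ^ (-p)) ≠ ∞ := by
  have hβ0 : 0 < β := lt_of_le_of_lt (by positivity) hβ
  have hne : ∀ z : ℝ, (n : ℝ) < z → ENNReal.ofReal (∏ i ∈ Finset.Icc 1 n, (z - (i : ℝ))) ≠ 0 :=
    fun z hz ↦ by simpa using prod_sub_pos hz
  have hIne := lintegral_rpow_neg_ne_zero hφm hφ0 hS0
  intro htop
  rcases lt_trichotomy p β with hlt | rfl | hgt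
  · have h := logconcave_prod_mul_lintegral_rpow_neg hS hφm hφ hφ0 hβ0 hI hp
      (show p < β + (β - p) by linarith) (a := 1 / 2) (b := 1 / 2) (by norm_num) (by norm_num)
      (by norm_num)
    rw [show 1 / 2 * p + 1 / 2 * (β + (β - p)) = β by ring, htop, ENNReal.mul_top (hne p hp),
      ENNReal.top_rpow_of_pos (by norm_num), ENNReal.top_mul, top_le_iff] at h
    · exact ENNReal.mul_ne_top ENNReal.ofReal_ne_top hI h
    · rw [Ne, ENNReal.rpow_eq_zero_iff_of_pos (by norm_num)]
      exact mul_ne_zero (hne _ (by linarith)) (hIne _)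
  · exact hI htop
  · have hden : 0 < p - (n + β) / 2 := by linarith
    have h := logconcave_prod_mul_lintegral_rpow_neg hS hφm hφ hφ0 hβ0 hI
      (show (n : ℝ) < (n + β) / 2 by linarith) (show (n + β) / 2 < p by linarith)
      (a := (p - β) / (p - (n + β) / 2)) (b := (β - (n + β) / 2) / (p - (n + β) / 2))
      (div_pos (by linarith) hden) (div_pos (by linarith) hden)
      (by rw [← add_div, div_eq_one_iff_eq hden.ne']; ring)
    rw [show (p - β) / (p - (n + β) / 2) * ((n + β) / 2) +
        (β - (n + β) / 2) / (p - (n + β) / 2) * p = β by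
          rw [div_mul_eq_mul_div, div_mul_eq_mul_div, ← add_div, div_eq_iff hden.ne']; ring,
      htop, ENNReal.mul_top (hne p hp),
      ENNReal.top_rpow_of_pos (div_pos (by linarith) hden), ENNReal.mul_top, top_le_iff] at h
    · exact ENNReal.mul_ne_top ENNReal.ofReal_ne_top hI h
    · rw [Ne, ENNReal.rpow_eq_zero_iff_of_pos (div_pos (by linarith) hden)]
      exact mul_ne_zero (hne _ (by linarith)) (hIne _)

lemma concaveOn_log_prod_mul_lintegral (hS : MeasurableSet S) (hS0 : volume S ≠ 0)
    (hφm : Measurable φ) (hφ : ConvexOn ℝ S φ) (hφ0 : ∀ x ∈ S, 0 < φ x) {β : ℝ} (hβ : (n : ℝ) < β)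
    (hI : ∫⁻ x in S, ENNReal.ofReal (φ x ^ (-β)) ≠ ∞) :
    ConcaveOn ℝ (Set.Ioi (n : ℝ)) fun p ↦ ∑ i ∈ Finset.Icc 1 n, Real.log (p - (i : ℝ)) +
      Real.log (∫⁻ x in S, ENNReal.ofReal (φ x ^ (-p))).toReal := by
  have hβ0 : 0 < β := lt_of_le_of_lt (by positivity) hβ
  have hfin : ∀ z : ℝ, (n : ℝ) < z → ∫⁻ x in S, ENNReal.ofReal (φ x ^ (-z)) ≠ ∞ := fun z hz ↦
    lintegral_rpow_neg_ne_top hS hS0 hφm hφ hφ0 hβ hI hz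
  have hpos : ∀ z : ℝ, (n : ℝ) < z → 0 < (∫⁻ x in S, ENNReal.ofReal (φ x ^ (-z))).toReal :=
    fun z hz ↦ ENNReal.toReal_pos (lintegral_rpow_neg_ne_zero hφm hφ0 hS0 z) (hfin z hz)
  have hlog : ∀ z : ℝ, (n : ℝ) < z → ∑ i ∈ Finset.Icc 1 n, Real.log (z - (i : ℝ)) +
      Real.log (∫⁻ x in S, ENNReal.ofReal (φ x ^ (-z))).toReal =
      Real.log (ENNReal.ofReal (∏ i ∈ Finset.Icc 1 n, (z - (i : ℝ))) *
        ∫⁻ x in S, ENNReal.ofReal (φ x ^ (-z))).toReal := fun z hz ↦ by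
    rw [ENNReal.toReal_mul, ENNReal.toReal_ofReal (prod_sub_pos hz).le,
      Real.log_mul (prod_sub_pos hz).ne' (hpos z hz).ne', Real.log_prod]
    intro i hi
    exact (sub_pos.2 (lt_of_le_of_lt (by exact_mod_cast (Finset.mem_Icc.1 hi).2) hz)).ne'
  have hGpos : ∀ z : ℝ, (n : ℝ) < z → 0 < (ENNReal.ofReal (∏ i ∈ Finset.Icc 1 n, (z - (i : ℝ))) *
      ∫⁻ x in S, ENNReal.ofReal (φ x ^ (-z))).toReal := fun z hz ↦ by
    rw [ENNReal.toReal_mul, ENNReal.toReal_ofReal (prod_sub_pos hz).le]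
    exact mul_pos (prod_sub_pos hz) (hpos z hz)
  refine LinearOrder.concaveOn_of_lt (convex_Ioi _) fun p hp r hr hpr a b ha hb hab ↦ ?_
  have hq : (n : ℝ) < a * p + b * r := convex_Ioi (n : ℝ) hp hr ha.le hb.le hab
  simp only [smul_eq_mul]
  rw [hlog p hp, hlog r hr, hlog _ hq]
  have h := ENNReal.toReal_mono (ENNReal.mul_ne_top ENNReal.ofReal_ne_top (hfin _ hq))
    (logconcave_prod_mul_lintegral_rpow_neg hS hφm hφ hφ0 hβ0 hI hp hpr ha hb hab)
  rw [ENNReal.toReal_mul, ← ENNReal.toReal_rpow, ← ENNReal.toReal_rpow] at h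
  have h1 := Real.rpow_pos_of_pos (hGpos p hp) a
  have h2 := Real.rpow_pos_of_pos (hGpos r hr) b
  have h' := Real.log_le_log (mul_pos h1 h2) h
  rwa [Real.log_mul h1.ne' h2.ne', Real.log_rpow (hGpos p hp), Real.log_rpow (hGpos r hr)] at h'

end Laplace

/-- A concave function on a set of reals lies below its tangent lines. -/
lemma ConcaveOn.le_add_mul_of_hasDerivAt {s : Set ℝ} {K : ℝ → ℝ} (hK : ConcaveOn ℝ s K)
    {x y K' : ℝ} (hx : x ∈ s) (hy : y ∈ s) (hd : HasDerivAt K K' x) :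
    K y ≤ K x + (y - x) * K' := by
  rcases lt_trichotomy x y with h | rfl | h
  · have := hK.slope_le_of_hasDerivAt hx hy h hd
    rw [slope_def_field, div_le_iff₀ (sub_pos.2 h)] at this
    linarith
  · simp
  · have := hK.le_slope_of_hasDerivAt hy hx h hd
    rw [slope_def_field, le_div_iff₀ (sub_pos.2 h)] at this
    linarith

section Concentration

variable {Ω : Type*} {mΩ : MeasurableSpace Ω} {μ : Measure Ω} {n : ℕ} {S : Set (Fin n → ℝ)}
  {φ : (Fin n → ℝ) → ℝ} {X : Ω → (Fin n → ℝ)} {β : ℝ}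

lemma lintegral_exp_mul_log_comp (hS : MeasurableSet S) (hφm : Measurable φ)
    (hφ0 : ∀ x ∈ S, 0 < φ x) (hX : Measurable X)
    (hmap : μ.map X = (volume.restrict S).withDensity fun x ↦ ENNReal.ofReal (φ x ^ (-β))) (α : ℝ) :
    ∫⁻ ω, ENNReal.ofReal (Real.exp (α * (β * Real.log (φ (X ω))))) ∂μ =
      ∫⁻ x in S, ENNReal.ofReal (φ x ^ (-((1 - α) * β))) := by
  rw [← lintegral_map (f := fun x ↦ ENNReal.ofReal (Real.exp (α * (β * Real.log (φ x)))))
    (by fun_prop) hX, hmap, lintegral_withDensity_eq_lintegral_mul _ (by fun_prop) (by fun_prop)]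
  refine setLIntegral_congr_fun hS fun x hx ↦ ?_
  have hx0 := hφ0 x hx
  rw [Pi.mul_apply, ← ENNReal.ofReal_mul (Real.rpow_nonneg hx0.le _),
    show α * (β * Real.log (φ x)) = Real.log (φ x) * (α * β) by ring, ← Real.rpow_def_of_pos hx0,
    ← Real.rpow_add hx0]
  ring_nf

/-- Moment generating function bound for the information content `β log φ(X)` of a random vector
with density `φ ^ (-β)` on `S`, where `φ` is convex. -/
lemma mgf_mul_log_comp_le [IsProbabilityMeasure μ] (hS : MeasurableSet S) (hφm : Measurable φ)
    (hφ : ConvexOn ℝ S φ) (hφ0 : ∀ x ∈ S, 0 < φ x) (hX : Measurable X) (hβ : (n : ℝ) < β)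
    (hmap : μ.map X = (volume.restrict S).withDensity fun x ↦ ENNReal.ofReal (φ x ^ (-β)))
    {α : ℝ} (hα : α < 1 - n / β) :
    mgf (fun ω ↦ β * Real.log (φ (X ω))) μ α ≤
      Real.exp (α * (∫ ω, β * Real.log (φ (X ω)) ∂μ) +
        (-α * β * (∑ i ∈ Finset.Icc 1 n, (β - (i : ℝ))⁻¹)
            - ∑ i ∈ Finset.Icc 1 n, Real.log (((1 - α) * β - (i : ℝ)) / (β - (i : ℝ))))) := by
  have hβ0 : 0 < β := lt_of_le_of_lt (by positivity) hβ
  set Y : Ω → ℝ := fun ω ↦ β * Real.log (φ (X ω)) with hY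
  have hYm : Measurable Y := by fun_prop
  have hlint := lintegral_exp_mul_log_comp hS hφm hφ0 hX hmap
  have hI1 : ∫⁻ x in S, ENNReal.ofReal (φ x ^ (-β)) = 1 := by
    simpa using (hlint 0).symm
  have hI : ∫⁻ x in S, ENNReal.ofReal (φ x ^ (-β)) ≠ ∞ := by simp [hI1]
  have hS0 : volume S ≠ 0 := fun h ↦ by
    simp [Measure.restrict_eq_zero.2 h] at hI1
  have hdom : ∀ t : ℝ, t < 1 - n / β → (n : ℝ) < (1 - t) * β := fun t ht ↦
    (div_lt_iff₀ hβ0).1 (by linarith)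
  have hmem0 : (0 : ℝ) < 1 - n / β := by
    rw [sub_pos, div_lt_one hβ0]; exact hβ
  have hmgf : ∀ t, mgf Y μ t = (∫⁻ x in S, ENNReal.ofReal (φ x ^ (-((1 - t) * β)))).toReal := by
    intro t
    rw [← hlint t, mgf, integral_eq_lintegral_of_nonneg_ae (.of_forall fun _ ↦ by positivity)
      (by fun_prop)]
  have hint : ∀ t < 1 - n / β, Integrable (fun ω ↦ Real.exp (t * Y ω)) μ := fun t ht ↦ by
    refine ⟨by fun_prop, ?_⟩
    rw [hasFiniteIntegral_iff_ofReal (.of_forall fun _ ↦ by positivity), hlint t]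
    exact (lintegral_rpow_neg_ne_top hS hS0 hφm hφ hφ0 hβ hI (hdom t ht)).lt_top
  have h0 : (0 : ℝ) ∈ interior (integrableExpSet Y μ) :=
    interior_maximal (fun t ht ↦ hint t ht) isOpen_Iio hmem0
  have hposi : ∀ t < 1 - n / β, ∀ i ∈ Finset.Icc 1 n, 0 < (1 - t) * β - (i : ℝ) :=
    fun t ht i hi ↦ sub_pos.2 (lt_of_le_of_lt
      (by exact_mod_cast (Finset.mem_Icc.1 hi).2) (hdom t ht))
  have hposβ : ∀ i ∈ Finset.Icc 1 n, 0 < β - (i : ℝ) := fun i hi ↦ by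
    simpa using hposi 0 hmem0 i hi
  let K : ℝ → ℝ := fun t ↦ ∑ i ∈ Finset.Icc 1 n, Real.log ((1 - t) * β - (i : ℝ)) +
    Real.log (mgf Y μ t)
  have hK : ConcaveOn ℝ (Set.Iio (1 - n / β)) K := by
    refine ⟨convex_Iio _, fun x hx y hy a b ha hb hab ↦ ?_⟩
    have h := (concaveOn_log_prod_mul_lintegral hS hS0 hφm hφ hφ0 hβ hI).2 (hdom x hx) (hdom y hy)
      ha hb hab
    have hcomb : a • ((1 - x) * β) + b • ((1 - y) * β) = (1 - (a • x + b • y)) * β := by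
      simp only [smul_eq_mul]; linear_combination β * hab
    rw [hcomb] at h
    simpa only [K, hmgf] using h
  have hd : HasDerivAt K (∑ i ∈ Finset.Icc 1 n, (-β) * (β - (i : ℝ))⁻¹ + ∫ ω, Y ω ∂μ) 0 := by
    refine HasDerivAt.add (HasDerivAt.fun_sum fun i hi ↦ ?_) ?_
    · have h1 : HasDerivAt (fun t : ℝ ↦ (1 - t) * β - (i : ℝ)) (-β) 0 := by
        simpa using (((hasDerivAt_id (0 : ℝ)).const_sub 1).mul_const β).sub_const (i : ℝ)
      simpa [div_eq_mul_inv] using h1.log (by simpa using (hposβ i hi).ne')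
    · have h1 := (hasDerivAt_mgf h0).log (by simp)
      simpa using h1
  have htan := hK.le_add_mul_of_hasDerivAt hmem0 hα hd
  have hmpos : 0 < mgf Y μ α := mgf_pos (hint α hα)
  rw [← Real.log_le_iff_le_exp hmpos]
  have hdiv : ∑ i ∈ Finset.Icc 1 n, Real.log (((1 - α) * β - (i : ℝ)) / (β - (i : ℝ))) =
      ∑ i ∈ Finset.Icc 1 n, Real.log ((1 - α) * β - (i : ℝ)) -
        ∑ i ∈ Finset.Icc 1 n, Real.log (β - (i : ℝ)) := by
    rw [← Finset.sum_sub_distrib]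
    exact Finset.sum_congr rfl fun i hi ↦
      Real.log_div (hposi α hα i hi).ne' (hposβ i hi).ne'
  simp only [K, sub_zero, one_mul, mgf_zero, Real.log_one, add_zero, ← Finset.mul_sum] at htan
  rw [hdiv]
  linarith

end Concentration

/-- Let `β > n` and let `X` be a random vector in `ℝⁿ` with `(-1/β)`-concave
density `f`. Then for all `α < 1 - n/β`,
`E[exp(α(h̃(X) - h(X)))] ≤ exp(ψ_c(α))`, where `h̃(X) = -log f(X)`, `h(X) = E[h̃(X)]` and
`ψ_c(α) = -αβ ∑_{i=1}^n (β-i)⁻¹ - ∑_{i=1}^n log(((1-α)β - i)/(β-i))`. -/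
theorem stmt15
    {Ω : Type*} [MeasureSpace Ω] [IsProbabilityMeasure (ℙ : Measure Ω)]
    (n : ℕ) (β : ℝ) (hβ : (n : ℝ) < β)
    (X : Ω → (Fin n → ℝ)) (hX : Measurable X)
    (f : (Fin n → ℝ) → ℝ) (hf_nonneg : ∀ x, 0 ≤ f x)
    (hf_density : Measure.map X ℙ = volume.withDensity (fun x => ENNReal.ofReal (f x)))
    (hf_conv : ConvexOn ℝ {x | 0 < f x} (fun x => f x ^ (-1 / β))) :
    ∀ α : ℝ, α < 1 - n / β →
      (∫ ω, Real.exp (α * (-Real.log (f (X ω)) - ∫ ω', -Real.log (f (X ω')))))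
        ≤ Real.exp (-α * β * (∑ i ∈ Finset.Icc 1 n, (β - (i : ℝ))⁻¹)
            - ∑ i ∈ Finset.Icc 1 n, Real.log (((1 - α) * β - (i : ℝ)) / (β - (i : ℝ)))) := by
  intro α hα
  have hβ0 : 0 < β := lt_of_le_of_lt (by positivity) hβ
  set S := interior {x | 0 < f x} with hSdef
  have hSm : MeasurableSet S := isOpen_interior.measurableSet
  have hSf : ∀ x ∈ S, 0 < f x := fun x hx ↦
    interior_subset (s := {x | 0 < f x}) hx
  let φ : (Fin n → ℝ) → ℝ := S.indicator fun x ↦ f x ^ (-1 / β)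
  have hφS : ∀ x ∈ S, φ x = f x ^ (-1 / β) := fun x hx ↦ Set.indicator_of_mem hx _
  have hφm : Measurable φ := by
    classical
    simpa only [φ, Set.piecewise_eq_indicator] using
      hf_conv.continuousOn_interior.measurable_piecewise (g := 0) continuousOn_const hSm
  have hφ : ConvexOn ℝ S φ :=
    (hf_conv.subset interior_subset hf_conv.1.interior).congr fun x hx ↦ (hφS x hx).symm
  have hφ0 : ∀ x ∈ S, 0 < φ x := fun x hx ↦ by
    rw [hφS x hx]; exact Real.rpow_pos_of_pos (hSf x hx) _
  have hfφ : ∀ x ∈ S, φ x ^ (-β) = f x := fun x hx ↦ by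
    rw [hφS x hx, ← Real.rpow_mul (hf_nonneg x)]
    simp [hβ0.ne']
  have hmap : Measure.map X ℙ =
      (volume.restrict S).withDensity fun x ↦ ENNReal.ofReal (φ x ^ (-β)) := by
    rw [hf_density, ← withDensity_indicator hSm]
    refine withDensity_congr_ae ?_
    have hfr : volume (frontier {x | 0 < f x}) = 0 := hf_conv.1.addHaar_frontier volume
    filter_upwards [compl_mem_ae_iff.2 hfr] with x hx
    by_cases hxS : x ∈ S
    · rw [Set.indicator_of_mem hxS, hfφ x hxS]
    · rw [Set.indicator_of_notMem hxS, ENNReal.ofReal_eq_zero]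
      by_contra! h
      exact hx ⟨subset_closure h, hxS⟩
  have hXS : ∀ᵐ ω, X ω ∈ S := by
    refine ae_of_ae_map hX.aemeasurable ?_
    rw [hmap]
    exact (withDensity_absolutelyContinuous _ _).ae_le (ae_restrict_mem hSm)
  have hlog : ∀ᵐ ω, -Real.log (f (X ω)) = β * Real.log (φ (X ω)) := by
    filter_upwards [hXS] with ω hω
    rw [← hfφ _ hω, Real.log_rpow (hφ0 _ hω)]
    ring
  have hmgf := mgf_mul_log_comp_le hSm hφm hφ hφ0 hX hβ hmap hα
  rw [integral_congr_ae hlog]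
  set h := ∫ ω, β * Real.log (φ (X ω))
  have hexp : ∫ ω, Real.exp (α * (-Real.log (f (X ω)) - h)) =
      mgf (fun ω ↦ β * Real.log (φ (X ω))) ℙ α * Real.exp (-(α * h)) := by
    rw [mgf, ← integral_mul_const]
    refine integral_congr_ae ?_
    filter_upwards [hlog] with ω hω
    rw [hω, ← Real.exp_add]
    ring_nf
  rw [hexp]
  refine (mul_le_mul_of_nonneg_right hmgf (Real.exp_nonneg _)).trans_eq ?_
  rw [← Real.exp_add]
  ring_nf
end

section
/- Let β > n and let X be a random vector in ℝⁿ with (-1/β)-concave density f. Then the entropy satisfies h(X) ≤ -log ‖f‖_∞ + β ∑_{i=1}^n (β - i)^{-1}, where ‖f‖_∞ is the essential supremum of f, with equality for Pareto distributions. -/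
open MeasureTheory ProbabilityTheory Real Set Filter Topology
open scoped Pointwise

theorem integrableOn_rpow_mul_log {β t : ℝ} (hβ : 0 < β) (ht : 1 ≤ t) :
    IntegrableOn (fun s : ℝ => s ^ (-β - 1) * log s) (Ioi t) ∧
      ∫ s in Ioi t, s ^ (-β - 1) * log s = t ^ (-β) * (log t / β + 1 / β ^ 2) := by
  have hderiv : ∀ s ∈ Ici t, HasDerivAt (fun s : ℝ => -(s ^ (-β) * (log s / β + 1 / β ^ 2)))
      (s ^ (-β - 1) * log s) s := by
    intro s hs
    have hs0 : 0 < s := lt_of_lt_of_le one_pos (ht.trans hs)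
    have h1 : HasDerivAt (fun s : ℝ => s ^ (-β)) (-β * s ^ (-β - 1)) s :=
      Real.hasDerivAt_rpow_const (Or.inl hs0.ne')
    have h2 : HasDerivAt (fun s : ℝ => log s / β + 1 / β ^ 2) (s⁻¹ / β) s :=
      ((Real.hasDerivAt_log hs0.ne').div_const β).add_const _
    refine (h1.mul h2).neg.congr_deriv ?_
    have h3 : s ^ (-β) = s ^ (-β - 1) * s := by
      rw [← Real.rpow_add_one hs0.ne']; ring_nf
    rw [h3]
    field_simp
    ring
  have hnonneg : ∀ s ∈ Ioi t, 0 ≤ s ^ (-β - 1) * log s := fun s hs => by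
    have : 1 ≤ s := ht.trans (le_of_lt hs)
    exact mul_nonneg (by positivity) (log_nonneg this)
  have hlim : Tendsto (fun s : ℝ => -(s ^ (-β) * (log s / β + 1 / β ^ 2))) atTop (𝓝 0) := by
    have h1 : Tendsto (fun s : ℝ => s ^ (-β)) atTop (𝓝 0) := tendsto_rpow_neg_atTop hβ
    have h2 : Tendsto (fun s : ℝ => log s / s ^ β) atTop (𝓝 0) :=
      (isLittleO_log_rpow_atTop hβ).tendsto_div_nhds_zero
    have h3 := ((h2.div_const β).add (h1.div_const (β ^ 2))).neg
    simp only [zero_div, add_zero, neg_zero] at h3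
    refine h3.congr' ?_
    filter_upwards [eventually_gt_atTop 0] with s hs
    rw [Real.rpow_neg hs.le]
    ring
  refine ⟨integrableOn_Ioi_deriv_of_nonneg' hderiv hnonneg hlim, ?_⟩
  rw [integral_Ioi_of_hasDerivAt_of_nonneg' hderiv hnonneg hlim]
  ring

theorem integral_Ioi_rpow_tail {β t : ℝ} (hβ : 0 < β) (ht : 1 ≤ t) :
    ∫ s in Ioi t, s ^ (-β - 1) = t ^ (-β) / β := by
  rw [integral_Ioi_rpow_of_lt (by linarith) (by linarith)]
  simp [neg_div_neg_eq]

theorem beta_integrals (n : ℕ) : ∀ β : ℝ, (n : ℝ) < β →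
    IntegrableOn (fun s : ℝ => s ^ (-β - 1) * (s - 1) ^ n) (Ioi 1) ∧
    IntegrableOn (fun s : ℝ => s ^ (-β - 1) * (s - 1) ^ n * log s) (Ioi 1) ∧
    ∫ s in Ioi (1 : ℝ), s ^ (-β - 1) * (s - 1) ^ n
      = n.factorial / ∏ i ∈ Finset.range (n + 1), (β - i) ∧
    ∫ s in Ioi (1 : ℝ), s ^ (-β - 1) * (s - 1) ^ n * log s
      = n.factorial / (∏ i ∈ Finset.range (n + 1), (β - i)) *
        ∑ i ∈ Finset.range (n + 1), (β - i)⁻¹ := by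
  induction n with
  | zero =>
    intro β hβ
    have hβ0 : 0 < β := by simpa using hβ
    have h := integrableOn_rpow_mul_log hβ0 le_rfl
    refine ⟨?_, ?_, ?_, ?_⟩
    · simpa using integrableOn_Ioi_rpow_of_lt (by linarith : -β - 1 < -1) one_pos
    · simpa using h.1
    · simpa using integral_Ioi_rpow_tail hβ0 le_rfl
    · simpa [sq] using h.2
  | succ n ih =>
    intro β hβ
    push_cast at hβ
    obtain ⟨hJ, hL, hJv, hLv⟩ := ih β (by linarith)
    obtain ⟨hJ', hL', hJv', hLv'⟩ := ih (β - 1) (by linarith)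
    have hrec : ∀ s ∈ Ioi (1 : ℝ), s ^ (-(β - 1) - 1) * (s - 1) ^ n - s ^ (-β - 1) * (s - 1) ^ n
        = s ^ (-β - 1) * (s - 1) ^ (n + 1) := by
      intro s hs
      have hs0 : 0 < s := one_pos.trans hs
      have : s ^ (-(β - 1) - 1) = s ^ (-β - 1) * s := by
        rw [← Real.rpow_add_one hs0.ne']; ring_nf
      rw [this]
      ring
    have hrec' : ∀ s ∈ Ioi (1 : ℝ), s ^ (-(β - 1) - 1) * (s - 1) ^ n * log s
        - s ^ (-β - 1) * (s - 1) ^ n * log s = s ^ (-β - 1) * (s - 1) ^ (n + 1) * log s := by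
      intro s hs
      rw [← hrec s hs]
      ring
    have hn0 : (0 : ℝ) ≤ n := n.cast_nonneg
    have hβ0 : β ≠ 0 := by linarith
    have hβn : β - (n + 1) ≠ 0 := by linarith
    have hP0 : ∏ i ∈ Finset.range (n + 1), (β - i) ≠ 0 := by
      rw [Finset.prod_ne_zero_iff]
      intro i hi
      have : (i : ℝ) ≤ n := by exact_mod_cast Nat.lt_succ_iff.mp (Finset.mem_range.mp hi)
      linarith
    have hcast : ∀ i : ℕ, β - ((i : ℝ) + 1) = β - 1 - i := fun i => by ring
    have hP : ∏ i ∈ Finset.range (n + 1 + 1), (β - i)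
        = (∏ i ∈ Finset.range (n + 1), (β - i)) * (β - (n + 1)) := by
      rw [Finset.prod_range_succ]; push_cast; rfl
    have hP' : (∏ i ∈ Finset.range (n + 1), (β - 1 - i)) * β
        = (∏ i ∈ Finset.range (n + 1), (β - i)) * (β - (n + 1)) := by
      rw [← hP, Finset.prod_range_succ' _ (n + 1)]
      simp [hcast]
    have hS : ∑ i ∈ Finset.range (n + 1), (β - i)⁻¹
        = ∑ i ∈ Finset.range (n + 1 + 1), (β - i)⁻¹ - (β - (n + 1))⁻¹ := by
      rw [Finset.sum_range_succ _ (n + 1)]; push_cast; ring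
    have hS' : ∑ i ∈ Finset.range (n + 1), (β - 1 - i)⁻¹
        = ∑ i ∈ Finset.range (n + 1 + 1), (β - i)⁻¹ - β⁻¹ := by
      rw [Finset.sum_range_succ' _ (n + 1)]; simp [hcast]
    have hP'' : ∏ i ∈ Finset.range (n + 1), (β - 1 - i)
        = (∏ i ∈ Finset.range (n + 1), (β - i)) * (β - (n + 1)) / β := by
      rw [← hP']; field_simp
    refine ⟨(hJ'.sub hJ).congr_fun hrec measurableSet_Ioi,
      (hL'.sub hL).congr_fun hrec' measurableSet_Ioi, ?_, ?_⟩
    · rw [← setIntegral_congr_fun measurableSet_Ioi hrec, integral_sub hJ' hJ, hJv, hJv', hP,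
        hP'', Nat.factorial_succ]
      push_cast
      field_simp
      ring
    · rw [← setIntegral_congr_fun measurableSet_Ioi hrec', integral_sub hL' hL, hLv, hLv', hP,
        hP'', hS, hS', Nat.factorial_succ]
      generalize ∑ i ∈ Finset.range (n + 1 + 1), (β - i)⁻¹ = S
      push_cast
      field_simp
      ring

theorem integral_tail_comp {α : Type*} [MeasurableSpace α] {μ : Measure α} [SFinite μ]
    {g : α → ℝ} (hg : AEMeasurable g μ) (hg1 : ∀ᵐ x ∂μ, 1 ≤ g x)
    (hfin : ∀ s, μ {x | g x < s} ≠ ⊤) {w : ℝ → ℝ}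
    (hw : AEStronglyMeasurable w (volume.restrict (Ioi 1)))
    (hint : IntegrableOn (fun s => w s * μ.real {x | g x < s}) (Ioi 1)) :
    Integrable (fun x => ∫ s in Ioi (g x), w s) μ ∧
      ∫ x, (∫ s in Ioi (g x), w s) ∂μ = ∫ s in Ioi 1, w s * μ.real {x | g x < s} := by
  have hnull : ∀ s, NullMeasurableSet {x | g x < s} μ := fun s =>
    nullMeasurableSet_lt hg aemeasurable_const
  set F : α × ℝ → ℝ := {p : α × ℝ | g p.1 < p.2}.indicator (fun p => w p.2) with hF
  have hFs : ∀ s, (fun x => F (x, s)) = {x | g x < s}.indicator (fun _ => w s) := by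
    intro s; ext x; simp [hF, indicator]
  have hFx : ∀ x, (fun s => F (x, s)) = (Ioi (g x)).indicator w := by
    intro x; ext s; simp [hF, indicator]
  have hFm : AEStronglyMeasurable F (μ.prod (volume.restrict (Ioi 1))) :=
    hw.comp_snd.indicator₀ (nullMeasurableSet_lt hg.comp_fst measurable_snd.aemeasurable)
  have hFint : Integrable F (μ.prod (volume.restrict (Ioi 1))) := by
    rw [integrable_prod_iff' hFm]
    constructor
    · refine ae_of_all _ fun s => ?_
      rw [hFs]
      exact (integrableOn_const (hfin s)).integrable_indicator₀ (hnull s)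
    · refine hint.norm.congr (ae_of_all _ fun s => ?_)
      have : (fun x => ‖F (x, s)‖) = {x | g x < s}.indicator (fun _ => ‖w s‖) := by
        ext x
        rw [← norm_indicator_eq_indicator_norm]
        exact congrArg norm (congrFun (hFs s) x)
      simp only [this]
      rw [integral_indicator₀ (hnull s), setIntegral_const]
      simp [mul_comm]
  have hinner : ∀ᵐ x ∂μ, ∫ s in Ioi 1, F (x, s) = ∫ s in Ioi (g x), w s := by
    filter_upwards [hg1] with x hx
    rw [hFx, setIntegral_indicator measurableSet_Ioi, inter_eq_self_of_subset_right]
    exact Ioi_subset_Ioi hx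
  refine ⟨hFint.integral_prod_left.congr hinner, ?_⟩
  rw [← integral_congr_ae hinner, integral_integral_swap (f := fun x s => F (x, s)) hFint]
  refine integral_congr_ae (ae_of_all _ fun s => ?_)
  simp only [hFs]
  rw [integral_indicator₀ (hnull s), setIntegral_const]
  simp [mul_comm]

/-- Layer-cake representation of `∫ g ^ (-β) (K - log g)` in terms of the distribution function
of `g`, when the latter grows at most polynomially. -/
theorem integral_rpow_mul_sub_log {α : Type*} [MeasurableSpace α] {μ : Measure α} [SFinite μ]
    {n : ℕ} {β : ℝ} (hβ : (n : ℝ) < β) {g : α → ℝ} (hg : AEMeasurable g μ)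
    (hg1 : ∀ᵐ x ∂μ, 1 ≤ g x) (hfin : ∀ s, μ {x | g x < s} ≠ ⊤) {C : ℝ}
    (hV : ∀ s, 1 < s → μ.real {x | g x < s} ≤ C * (1 + (s - 1) ^ n)) :
    Integrable (fun x => g x ^ (-β)) μ ∧ Integrable (fun x => g x ^ (-β) * log (g x)) μ ∧
    ∀ K : ℝ,
      IntegrableOn (fun s : ℝ => s ^ (-β - 1) * (1 + β * (K - log s)) * μ.real {x | g x < s})
        (Ioi 1) ∧
      K * ∫ x, g x ^ (-β) ∂μ - ∫ x, g x ^ (-β) * log (g x) ∂μ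
        = ∫ s in Ioi (1 : ℝ), s ^ (-β - 1) * (1 + β * (K - log s)) * μ.real {x | g x < s} := by
  have hβ0 : 0 < β := lt_of_le_of_lt n.cast_nonneg hβ
  have hVm : Measurable fun s => μ.real {x | g x < s} :=
    Monotone.measurable fun s t hst =>
      measureReal_mono (fun x (hx : g x < s) => lt_of_lt_of_le hx hst) (hfin t)
  obtain ⟨hJ, hL, -, -⟩ := beta_integrals n β hβ
  obtain ⟨hJ0, hL0, -, -⟩ := beta_integrals 0 β (by simpa using hβ0)
  simp only [pow_zero, mul_one] at hJ0 hL0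
  have hA : IntegrableOn (fun s : ℝ => s ^ (-β - 1) * μ.real {x | g x < s}) (Ioi 1) := by
    refine ((hJ0.add hJ).const_mul C).mono' (hJ0.1.mul hVm.aestronglyMeasurable) ?_
    filter_upwards [ae_restrict_mem measurableSet_Ioi] with s hs
    have hs0 : 0 < s := one_pos.trans hs
    rw [Real.norm_of_nonneg (by positivity)]
    calc s ^ (-β - 1) * μ.real {x | g x < s}
        ≤ s ^ (-β - 1) * (C * (1 + (s - 1) ^ n)) := by gcongr; exact hV s hs
      _ = _ := by simp only [Pi.add_apply]; ring
  have hB : IntegrableOn (fun s : ℝ => s ^ (-β - 1) * log s * μ.real {x | g x < s}) (Ioi 1) := by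
    refine ((hL0.add hL).const_mul C).mono' (hL0.1.mul hVm.aestronglyMeasurable) ?_
    filter_upwards [ae_restrict_mem measurableSet_Ioi] with s hs
    have hs0 : 0 < s := one_pos.trans hs
    have hlog : 0 ≤ log s := log_nonneg (le_of_lt hs)
    rw [Real.norm_of_nonneg (by positivity)]
    calc s ^ (-β - 1) * log s * μ.real {x | g x < s}
        ≤ s ^ (-β - 1) * log s * (C * (1 + (s - 1) ^ n)) := by gcongr; exact hV s hs
      _ = _ := by simp only [Pi.add_apply]; ring
  obtain ⟨hAi, hAv⟩ := integral_tail_comp hg hg1 hfin hJ0.1 hA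
  obtain ⟨hBi, hBv⟩ := integral_tail_comp hg hg1 hfin hL0.1 hB
  have hAe : ∀ᵐ x ∂μ, ∫ s in Ioi (g x), s ^ (-β - 1) = g x ^ (-β) / β := by
    filter_upwards [hg1] with x hx using integral_Ioi_rpow_tail hβ0 hx
  have hBe : ∀ᵐ x ∂μ, ∫ s in Ioi (g x), s ^ (-β - 1) * log s
      = g x ^ (-β) * (log (g x) / β + 1 / β ^ 2) := by
    filter_upwards [hg1] with x hx using (integrableOn_rpow_mul_log hβ0 hx).2
  have h1 : (fun x => β * ∫ s in Ioi (g x), s ^ (-β - 1)) =ᵐ[μ] fun x => g x ^ (-β) := by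
    filter_upwards [hAe] with x hx
    rw [hx]
    field_simp
  have h2 : (fun x => β * (∫ s in Ioi (g x), s ^ (-β - 1) * log s)
      - ∫ s in Ioi (g x), s ^ (-β - 1)) =ᵐ[μ] fun x => g x ^ (-β) * log (g x) := by
    filter_upwards [hAe, hBe] with x hx hx'
    rw [hx, hx']
    field_simp
    ring
  refine ⟨(hAi.const_mul β).congr h1, ((hBi.const_mul β).sub hAi).congr h2, fun K => ?_⟩
  have hsplit : (fun s : ℝ => s ^ (-β - 1) * (1 + β * (K - log s)) * μ.real {x | g x < s})
      = fun s => (1 + β * K) * (s ^ (-β - 1) * μ.real {x | g x < s})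
        - β * (s ^ (-β - 1) * log s * μ.real {x | g x < s}) := by
    ext s; ring
  rw [hsplit]
  refine ⟨(hA.const_mul _).sub (hB.const_mul _), ?_⟩
  rw [integral_sub (hA.const_mul _) (hB.const_mul _), integral_const_mul, integral_const_mul,
    ← hAv, ← hBv, ← integral_congr_ae h1, ← integral_congr_ae h2,
    integral_sub (hBi.const_mul β) hAi, integral_const_mul, integral_const_mul]
  ring

theorem integral_pareto_weight_eq_zero {n : ℕ} {β : ℝ} (hβ : (n : ℝ) < β) :
    IntegrableOn (fun s : ℝ => s ^ (-β - 1) *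
      (1 + β * (∑ i ∈ Finset.Icc 1 n, (β - (i : ℝ))⁻¹ - log s)) * (s - 1) ^ n) (Ioi 1) ∧
    ∫ s in Ioi (1 : ℝ), s ^ (-β - 1) *
      (1 + β * (∑ i ∈ Finset.Icc 1 n, (β - (i : ℝ))⁻¹ - log s)) * (s - 1) ^ n = 0 := by
  have hβ0 : 0 < β := lt_of_le_of_lt n.cast_nonneg hβ
  obtain ⟨hJ, hL, hJv, hLv⟩ := beta_integrals n β hβ
  have hS : ∑ i ∈ Finset.range (n + 1), (β - (i : ℝ))⁻¹
      = ∑ i ∈ Finset.Icc 1 n, (β - (i : ℝ))⁻¹ + β⁻¹ := by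
    rw [Finset.range_eq_Ico, Finset.sum_eq_sum_Ico_succ_bot (by simp), add_comm]
    simp [Finset.Ico_add_one_right_eq_Icc]
  set K := ∑ i ∈ Finset.Icc 1 n, (β - (i : ℝ))⁻¹
  have hsplit : (fun s : ℝ => s ^ (-β - 1) * (1 + β * (K - log s)) * (s - 1) ^ n)
      = fun s => (1 + β * K) * (s ^ (-β - 1) * (s - 1) ^ n)
        - β * (s ^ (-β - 1) * (s - 1) ^ n * log s) := by
    ext s; ring
  rw [hsplit]
  refine ⟨(hJ.const_mul _).sub (hL.const_mul _), ?_⟩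
  rw [integral_sub (hJ.const_mul _) (hL.const_mul _), integral_const_mul, integral_const_mul,
    hLv, hJv, hS]
  field_simp
  ring

theorem integral_rpow_mul_log_le {α : Type*} [MeasurableSpace α] {μ : Measure α} [SFinite μ]
    {n : ℕ} {β : ℝ} (hβ : (n : ℝ) < β) {g : α → ℝ} (hg : AEMeasurable g μ)
    (hg1 : ∀ᵐ x ∂μ, 1 ≤ g x) (hfin : ∀ s, μ {x | g x < s} ≠ ⊤)
    (hV : ∀ s t, 1 < s → s < t →
      μ.real {x | g x < t} * (s - 1) ^ n ≤ μ.real {x | g x < s} * (t - 1) ^ n) :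
    Integrable (fun x => g x ^ (-β)) μ ∧ Integrable (fun x => g x ^ (-β) * log (g x)) μ ∧
    ∫ x, g x ^ (-β) * log (g x) ∂μ
      ≤ (∑ i ∈ Finset.Icc 1 n, (β - (i : ℝ))⁻¹) * ∫ x, g x ^ (-β) ∂μ := by
  have hβ0 : 0 < β := lt_of_le_of_lt n.cast_nonneg hβ
  have hgrowth : ∀ s, 1 < s →
      μ.real {x | g x < s} ≤ μ.real {x | g x < 2} * (1 + (s - 1) ^ n) := by
    intro s hs
    have hpow : 0 ≤ (s - 1) ^ n := pow_nonneg (by linarith) n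
    rcases le_or_gt s 2 with h | h
    · calc μ.real {x | g x < s} ≤ μ.real {x | g x < 2} :=
            measureReal_mono (fun x (hx : g x < s) => lt_of_lt_of_le hx h) (hfin 2)
        _ ≤ _ := le_mul_of_one_le_right measureReal_nonneg (by linarith)
    · have := hV 2 s one_lt_two h
      norm_num at this
      nlinarith [measureReal_nonneg (μ := μ) (s := {x | g x < 2})]
  obtain ⟨hi, hil, hK⟩ := integral_rpow_mul_sub_log hβ hg hg1 hfin hgrowth
  refine ⟨hi, hil, ?_⟩
  obtain ⟨hwi, hwv⟩ := integral_pareto_weight_eq_zero hβ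
  have hK0 : 0 ≤ ∑ i ∈ Finset.Icc 1 n, (β - (i : ℝ))⁻¹ := by
    refine Finset.sum_nonneg fun i hi => inv_nonneg.mpr ?_
    have : (i : ℝ) ≤ n := by exact_mod_cast (Finset.mem_Icc.mp hi).2
    linarith
  set K := ∑ i ∈ Finset.Icc 1 n, (β - (i : ℝ))⁻¹
  obtain ⟨hKi, hKv⟩ := hK K
  set u := exp (K + 1 / β)
  have hu : 1 < u := one_lt_exp_iff.mpr (by positivity)
  have hupow : 0 < (u - 1) ^ n := pow_pos (by linarith) n
  set c := μ.real {x | g x < u} / (u - 1) ^ n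
  have hc : c * (u - 1) ^ n = μ.real {x | g x < u} := div_mul_cancel₀ _ hupow.ne'
  have hmono : c * ∫ s in Ioi (1 : ℝ), s ^ (-β - 1) * (1 + β * (K - log s)) * (s - 1) ^ n
      ≤ ∫ s in Ioi (1 : ℝ), s ^ (-β - 1) * (1 + β * (K - log s)) * μ.real {x | g x < s} := by
    rw [← integral_const_mul]
    refine setIntegral_mono_on (hwi.const_mul c) hKi measurableSet_Ioi fun s hs => ?_
    have hs0 : 0 < s := one_pos.trans hs
    have hsw : 0 ≤ s ^ (-β - 1) := by positivity
    have hlogu : 1 + β * (K - log u) = 0 := by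
      simp only [u, log_exp]
      field_simp
      ring
    have hkey : c * ((1 + β * (K - log s)) * (s - 1) ^ n)
        ≤ (1 + β * (K - log s)) * μ.real {x | g x < s} := by
      rcases lt_trichotomy s u with h | h | h
      · have hle := hV s u hs h
        rw [← hc] at hle
        have h1 : c * (s - 1) ^ n ≤ μ.real {x | g x < s} := by
          refine le_of_mul_le_mul_right ?_ hupow
          linarith
        have h2 : 0 ≤ 1 + β * (K - log s) := by
          have := log_le_log hs0 h.le
          nlinarith
        nlinarith
      · rw [h, hlogu]; simp
      · have hle := hV u s hu h
        rw [← hc] at hle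
        have h1 : μ.real {x | g x < s} ≤ c * (s - 1) ^ n := by
          refine le_of_mul_le_mul_right ?_ hupow
          linarith
        have h2 : 1 + β * (K - log s) ≤ 0 := by
          have := log_le_log (one_pos.trans hu) h.le
          nlinarith
        nlinarith
    calc _ = s ^ (-β - 1) * (c * ((1 + β * (K - log s)) * (s - 1) ^ n)) := by ring
      _ ≤ s ^ (-β - 1) * ((1 + β * (K - log s)) * μ.real {x | g x < s}) := by gcongr
      _ = _ := by ring
  rw [hwv, mul_zero, ← hKv] at hmono
  linarith

theorem integral_rpow_mul_log_eq {α : Type*} [MeasurableSpace α] {μ : Measure α} [SFinite μ]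
    {n : ℕ} {β : ℝ} (hβ : (n : ℝ) < β) {g : α → ℝ} (hg : AEMeasurable g μ)
    (hg1 : ∀ᵐ x ∂μ, 1 ≤ g x) (hfin : ∀ s, μ {x | g x < s} ≠ ⊤) {c : ℝ}
    (hV : ∀ s, 1 < s → μ.real {x | g x < s} = c * (s - 1) ^ n) :
    Integrable (fun x => g x ^ (-β)) μ ∧ Integrable (fun x => g x ^ (-β) * log (g x)) μ ∧
    ∫ x, g x ^ (-β) * log (g x) ∂μ
      = (∑ i ∈ Finset.Icc 1 n, (β - (i : ℝ))⁻¹) * ∫ x, g x ^ (-β) ∂μ := by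
  have hc : 0 ≤ c := by
    have h := hV 2 one_lt_two
    norm_num at h
    exact h ▸ measureReal_nonneg
  obtain ⟨hi, hil, hK⟩ := integral_rpow_mul_sub_log hβ hg hg1 hfin (C := c)
    fun s hs => (hV s hs).trans_le (by gcongr; linarith)
  refine ⟨hi, hil, ?_⟩
  have hKv := (hK (∑ i ∈ Finset.Icc 1 n, (β - (i : ℝ))⁻¹)).2
  have hzero : ∫ s in Ioi (1 : ℝ), s ^ (-β - 1) *
      (1 + β * (∑ i ∈ Finset.Icc 1 n, (β - (i : ℝ))⁻¹ - log s)) * μ.real {x | g x < s} = 0 := by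
    rw [← mul_zero c, ← (integral_pareto_weight_eq_zero hβ).2, ← integral_const_mul]
    refine setIntegral_congr_fun measurableSet_Ioi fun s hs => ?_
    simp only [hV s hs]
    ring
  linarith

theorem essSup_eq_of_isOpen {α : Type*} [TopologicalSpace α] [MeasurableSpace α] {μ : Measure α}
    [μ.IsOpenPosMeasure] {f : α → ℝ} {U : Set α} (hU : IsOpen U) (hf : ContinuousOn f U) {M : ℝ}
    (hle : ∀ᵐ x ∂μ, f x ≤ M) (hsup : ∀ δ < M, ∃ x ∈ U, δ < f x) : essSup f μ = M := by
  rw [essSup_eq_sInf]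
  have hM : M ∈ {a : ℝ | μ {x | a < f x} = 0} := by
    simpa [ae_iff] using hle
  have hlb : ∀ a ∈ {a : ℝ | μ {x | a < f x} = 0}, M ≤ a := by
    intro a ha
    by_contra! h
    obtain ⟨x, hxU, hx⟩ := hsup a h
    have hopen : IsOpen (U ∩ f ⁻¹' Ioi a) := hf.isOpen_inter_preimage hU isOpen_Ioi
    exact hopen.measure_ne_zero μ ⟨x, hxU, hx⟩ (measure_mono_null (fun y hy => hy.2) ha)
  exact IsLeast.csInf_eq ⟨hM, hlb⟩

theorem ConvexOn.volume_sublevel_le {n : ℕ} {U : Set (Fin n → ℝ)} {φ : (Fin n → ℝ) → ℝ}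
    (hφ : ConvexOn ℝ U φ) (hfin : ∀ s, volume {x ∈ U | φ x < s} ≠ ⊤) {m : ℝ}
    (hm : ∀ x ∈ U, m ≤ φ x) (hinf : ∀ δ, m < δ → ∃ x ∈ U, φ x < δ) {s t : ℝ}
    (hs : m < s) (hst : s < t) :
    volume.real {x ∈ U | φ x < t} * (s - m) ^ n ≤ volume.real {x ∈ U | φ x < s} * (t - m) ^ n := by
  have hpoint : ∀ x₀ ∈ U, φ x₀ < s → volume.real {x ∈ U | φ x < t} * (s - φ x₀) ^ n
      ≤ volume.real {x ∈ U | φ x < s} * (t - φ x₀) ^ n := by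
    intro x₀ hx₀ hlt
    have ht0 : 0 < t - φ x₀ := by linarith
    set r := (s - φ x₀) / (t - φ x₀)
    have hr0 : 0 < r := div_pos (by linarith) ht0
    have hr1 : r ≤ 1 := (div_le_one ht0).mpr (by linarith)
    have hrt : r * (t - φ x₀) = s - φ x₀ := div_mul_cancel₀ _ ht0.ne'
    have hsub : AffineMap.homothety x₀ r '' {x ∈ U | φ x < t} ⊆ {x ∈ U | φ x < s} := by
      rintro _ ⟨x, ⟨hxU, hx⟩, rfl⟩
      have heq : AffineMap.homothety x₀ r x = (1 - r) • x₀ + r • x := by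
        rw [AffineMap.homothety_apply, vsub_eq_sub, vadd_eq_add, smul_sub, sub_smul, one_smul]
        abel
      rw [heq]
      have h1r : 0 ≤ 1 - r := by linarith
      refine ⟨hφ.1 hx₀ hxU h1r hr0.le (by ring), ?_⟩
      calc φ ((1 - r) • x₀ + r • x) ≤ (1 - r) * φ x₀ + r * φ x :=
            hφ.2 hx₀ hxU h1r hr0.le (by ring)
        _ < (1 - r) * φ x₀ + r * t := by gcongr
        _ = s := by linarith
    have hvol := measureReal_mono hsub (hfin s)
    rw [measureReal_def, Measure.addHaar_image_homothety, ENNReal.toReal_mul,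
      ENNReal.toReal_ofReal (abs_nonneg _), ← measureReal_def, Module.finrank_fin_fun,
      abs_of_nonneg (by positivity)] at hvol
    calc volume.real {x ∈ U | φ x < t} * (s - φ x₀) ^ n
        = r ^ n * volume.real {x ∈ U | φ x < t} * (t - φ x₀) ^ n := by
          rw [← hrt, mul_pow]; ring
      _ ≤ _ := by gcongr
  have hlim : Tendsto (fun δ => volume.real {x ∈ U | φ x < t} * (s - δ) ^ n) (𝓝[>] m)
      (𝓝 (volume.real {x ∈ U | φ x < t} * (s - m) ^ n)) :=
    (Continuous.tendsto (by fun_prop) m).mono_left nhdsWithin_le_nhds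
  refine le_of_tendsto hlim ?_
  filter_upwards [Ioo_mem_nhdsGT hs] with δ hδ
  obtain ⟨x₀, hx₀, hlt⟩ := hinf δ hδ.1
  have hmx := hm x₀ hx₀
  calc volume.real {x ∈ U | φ x < t} * (s - δ) ^ n
      ≤ volume.real {x ∈ U | φ x < t} * (s - φ x₀) ^ n := by
        have : 0 ≤ s - δ := by linarith [hδ.2]
        gcongr
    _ ≤ volume.real {x ∈ U | φ x < s} * (t - φ x₀) ^ n := hpoint x₀ hx₀ (hlt.trans hδ.2)
    _ ≤ _ := by
        have : 0 ≤ t - φ x₀ := by linarith [hδ.2]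
        gcongr

/-- A positive convex function whose power `-β`, `β > n`, has finite integral over an open set
is bounded away from zero there. -/
theorem ConvexOn.exists_pos_infimum {n : ℕ} {β : ℝ} (hβ : (n : ℝ) < β) {U : Set (Fin n → ℝ)}
    (hU : IsOpen U) (hne : U.Nonempty) {φ : (Fin n → ℝ) → ℝ} (hφ : ConvexOn ℝ U φ)
    (hcont : ContinuousOn φ U) (hpos : ∀ x ∈ U, 0 < φ x)
    (hint : ∫⁻ x in U, ENNReal.ofReal (φ x ^ (-β)) ≤ 1) :
    (∀ s, volume {x ∈ U | φ x < s} ≠ ⊤) ∧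
    ∃ m, 0 < m ∧ (∀ x ∈ U, m ≤ φ x) ∧ ∀ δ, m < δ → ∃ x ∈ U, φ x < δ := by
  have hβ0 : 0 < β := lt_of_le_of_lt n.cast_nonneg hβ
  have hopen : ∀ s, IsOpen {x ∈ U | φ x < s} := fun s =>
    hcont.isOpen_inter_preimage hU isOpen_Iio
  have hmarkov : ∀ s, 0 < s → volume {x ∈ U | φ x < s} ≤ ENNReal.ofReal (s ^ β) := by
    intro s hs
    have hsβ : 0 < s ^ β := by positivity
    have h : ENNReal.ofReal (s ^ (-β)) * volume {x ∈ U | φ x < s} ≤ 1 := by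
      calc ENNReal.ofReal (s ^ (-β)) * volume {x ∈ U | φ x < s}
          = ∫⁻ _ in {x ∈ U | φ x < s}, ENNReal.ofReal (s ^ (-β)) := (setLIntegral_const _ _).symm
        _ ≤ ∫⁻ x in {x ∈ U | φ x < s}, ENNReal.ofReal (φ x ^ (-β)) := by
            refine setLIntegral_mono' (hopen s).measurableSet fun x hx => ?_
            exact ENNReal.ofReal_le_ofReal
              (Real.rpow_le_rpow_of_nonpos (hpos x hx.1) hx.2.le (by linarith))
        _ ≤ ∫⁻ x in U, ENNReal.ofReal (φ x ^ (-β)) := lintegral_mono_set fun x hx => hx.1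
        _ ≤ 1 := hint
    calc volume {x ∈ U | φ x < s}
        = ENNReal.ofReal (s ^ β) * (ENNReal.ofReal (s ^ (-β)) * volume {x ∈ U | φ x < s}) := by
          rw [← mul_assoc, ← ENNReal.ofReal_mul hsβ.le, ← Real.rpow_add hs]
          simp
      _ ≤ ENNReal.ofReal (s ^ β) * 1 := by gcongr
      _ = _ := mul_one _
  have hfin : ∀ s, volume {x ∈ U | φ x < s} ≠ ⊤ := by
    intro s
    refine ne_top_of_le_ne_top (ENNReal.ofReal_ne_top (r := (max s 1) ^ β)) ?_
    have hsub : {x ∈ U | φ x < s} ⊆ {x ∈ U | φ x < max s 1} := fun x hx =>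
      ⟨hx.1, hx.2.trans_le (le_max_left s 1)⟩
    exact (measure_mono hsub).trans (hmarkov _ (by positivity))
  have hm : ∀ x ∈ U, sInf (φ '' U) ≤ φ x := fun x hx =>
    csInf_le ⟨0, by rintro _ ⟨y, hy, rfl⟩; exact (hpos y hy).le⟩ (mem_image_of_mem φ hx)
  have hinf : ∀ δ, sInf (φ '' U) < δ → ∃ x ∈ U, φ x < δ := fun δ hδ => by
    obtain ⟨_, ⟨x, hx, rfl⟩, hlt⟩ := exists_lt_of_csInf_lt (hne.image φ) hδ
    exact ⟨x, hx, hlt⟩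
  refine ⟨hfin, _, ?_, hm, hinf⟩
  have hm0 : 0 ≤ sInf (φ '' U) := by
    refine le_csInf (hne.image φ) ?_
    rintro _ ⟨y, hy, rfl⟩
    exact (hpos y hy).le
  refine hm0.lt_of_ne fun h0 => ?_
  rw [← h0] at hm hinf
  have hV1 : 0 < volume.real {x ∈ U | φ x < 1} := by
    obtain ⟨x, hx⟩ := hinf 1 one_pos
    exact ENNReal.toReal_pos ((hopen 1).measure_ne_zero volume ⟨x, hx⟩) (hfin 1)
  have hlow : ∀ s ∈ Ioo (0 : ℝ) 1, volume.real {x ∈ U | φ x < 1} ≤ s ^ (β - n) := by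
    intro s hs
    have h1 := hφ.volume_sublevel_le hfin hm hinf hs.1 hs.2
    have h2 : volume.real {x ∈ U | φ x < s} ≤ s ^ β :=
      ENNReal.toReal_le_of_le_ofReal (by have := hs.1; positivity) (hmarkov s hs.1)
    simp only [sub_zero, one_pow, mul_one] at h1
    rw [Real.rpow_sub hs.1, Real.rpow_natCast, le_div_iff₀ (pow_pos hs.1 n)]
    exact h1.trans h2
  have hlim : Tendsto (fun s : ℝ => s ^ (β - n)) (𝓝[>] 0) (𝓝 0) := by
    have h := (Real.continuousAt_rpow_const 0 (β - n) (Or.inr (by linarith))).tendsto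
    rw [Real.zero_rpow (by linarith)] at h
    exact h.mono_left nhdsWithin_le_nhds
  refine hV1.not_ge (ge_of_tendsto hlim ?_)
  filter_upwards [Ioo_mem_nhdsGT one_pos] with s hs using hlow s hs

/-- The entropy of a density of the form `M g ^ (-β)` on a set `U`. -/
theorem neg_integral_mul_log_eq {α : Type*} [MeasurableSpace α] {μ : Measure α} {U : Set α}
    (hU : MeasurableSet U) {f g : α → ℝ} {M β : ℝ} (hM : 0 < M) (hg : ∀ x ∈ U, 1 ≤ g x)
    (hf : ∀ x ∈ U, f x = M * g x ^ (-β)) (hf0 : ∀ᵐ x ∂μ, x ∉ U → f x = 0)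
    (hone : ∫ x in U, f x ∂μ = 1)
    (hi : IntegrableOn (fun x => g x ^ (-β)) U μ)
    (hil : IntegrableOn (fun x => g x ^ (-β) * log (g x)) U μ) :
    M * ∫ x in U, g x ^ (-β) ∂μ = 1 ∧
    -∫ x, f x * log (f x) ∂μ = -log M + β * (M * ∫ x in U, g x ^ (-β) * log (g x) ∂μ) := by
  have h1 : M * ∫ x in U, g x ^ (-β) ∂μ = 1 := by
    rw [← hone, ← integral_const_mul]
    exact (setIntegral_congr_fun hU hf).symm
  refine ⟨h1, ?_⟩
  have hres : ∫ x, f x * log (f x) ∂μ = ∫ x in U, f x * log (f x) ∂μ := by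
    refine (setIntegral_eq_integral_of_ae_compl_eq_zero ?_).symm
    filter_upwards [hf0] with x hx hxU
    simp [hx hxU]
  have hU' : ∫ x in U, f x * log (f x) ∂μ
      = ∫ x in U, (M * log M) * g x ^ (-β) - (M * β) * (g x ^ (-β) * log (g x)) ∂μ := by
    refine setIntegral_congr_fun hU fun x hx => ?_
    have hg0 : 0 < g x := one_pos.trans_le (hg x hx)
    simp only [hf x hx]
    rw [log_mul hM.ne' (by positivity), log_rpow hg0]
    ring
  rw [hres, hU', integral_sub (hi.const_mul _) (hil.const_mul _), integral_const_mul,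
    integral_const_mul]
  linear_combination (-log M) * h1

theorem entropy_le_of_convexOn {n : ℕ} {β : ℝ} (hβ : (n : ℝ) < β) {f : (Fin n → ℝ) → ℝ}
    (hf_nonneg : ∀ x, 0 ≤ f x) (hf_one : ∫⁻ x, ENNReal.ofReal (f x) = 1)
    (hf_conv : ConvexOn ℝ {x | 0 < f x} (fun x => f x ^ (-1 / β))) :
    (-∫ x, f x * log (f x))
      ≤ -log (essSup f volume) + β * ∑ i ∈ Finset.Icc 1 n, (β - (i : ℝ))⁻¹ := by
  have hβ0 : 0 < β := lt_of_le_of_lt n.cast_nonneg hβ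
  set φ : (Fin n → ℝ) → ℝ := fun x => f x ^ (-1 / β) with hφdef
  set U := interior {x | 0 < f x} with hUdef
  have hU : IsOpen U := isOpen_interior
  have hfφ : ∀ x, f x = φ x ^ (-β) := fun x => by
    simp only [hφdef]
    rw [← Real.rpow_mul (hf_nonneg x), show -1 / β * -β = 1 by field_simp, Real.rpow_one]
  have hcont : ContinuousOn φ U := hf_conv.continuousOn_interior
  have hconv : ConvexOn ℝ U φ := hf_conv.subset interior_subset hf_conv.1.interior
  have hpos : ∀ x ∈ U, 0 < φ x := fun x hx => by
    have : x ∈ {x | 0 < f x} := interior_subset hx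
    exact Real.rpow_pos_of_pos this _
  have hf0 : ∀ᵐ x ∂(volume : Measure (Fin n → ℝ)), x ∉ U → f x = 0 := by
    refine measure_mono_null (fun x hx => ?_) (hf_conv.1.addHaar_frontier volume)
    simp only [mem_compl_iff, mem_ofPred_eq, Classical.not_imp] at hx
    exact ⟨subset_closure (lt_of_le_of_ne (hf_nonneg x) (Ne.symm hx.2)), hx.1⟩
  have hU_one : ∫⁻ x in U, ENNReal.ofReal (f x) = 1 := by
    rw [← hf_one, ← lintegral_indicator hU.measurableSet]
    refine lintegral_congr_ae ?_
    filter_upwards [hf0] with x hx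
    by_cases h : x ∈ U
    · simp [h]
    · simp [h, hx h]
  have hne : U.Nonempty := by
    by_contra h
    rw [not_nonempty_iff_eq_empty.mp h] at hU_one
    simp at hU_one
  obtain ⟨hfin, m, hm0, hm, hinf⟩ := hconv.exists_pos_infimum hβ hU hne hcont hpos
    (by simpa only [← hfφ] using hU_one.le)
  have hM0 : 0 < m ^ (-β) := by positivity
  have hfcont : ContinuousOn f U := by
    rw [show f = fun x => φ x ^ (-β) from funext hfφ]
    exact hcont.rpow_const fun x hx => Or.inl (hpos x hx).ne'
  have hess : essSup f volume = m ^ (-β) := by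
    refine essSup_eq_of_isOpen hU hfcont ?_ fun δ hδ => ?_
    · filter_upwards [hf0] with x hx
      by_cases h : x ∈ U
      · rw [hfφ]
        exact Real.rpow_le_rpow_of_nonpos hm0 (hm x h) (by linarith)
      · rw [hx h]
        exact hM0.le
    · have hlim : Tendsto (fun t : ℝ => t ^ (-β)) (𝓝[>] m) (𝓝 (m ^ (-β))) :=
        (Real.continuousAt_rpow_const m (-β) (Or.inl hm0.ne')).tendsto.mono_left
          nhdsWithin_le_nhds
      obtain ⟨t, ht, hmt⟩ :=
        ((hlim.eventually_const_lt hδ).and self_mem_nhdsWithin).exists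
      obtain ⟨x, hxU, hx⟩ := hinf t hmt
      refine ⟨x, hxU, ht.trans_le ?_⟩
      rw [hfφ]
      exact Real.rpow_le_rpow_of_nonpos (hpos x hxU) hx.le (by linarith)
  have hlevel : ∀ s, {x | φ x / m < s} ∩ U = {x ∈ U | φ x < m * s} := fun s => by
    ext x
    simp [div_lt_iff₀' hm0, and_comm]
  have hg1 : ∀ x ∈ U, 1 ≤ φ x / m := fun x hx => (one_le_div hm0).mpr (hm x hx)
  obtain ⟨hi, hil, hle⟩ := integral_rpow_mul_log_le (μ := volume.restrict U) hβ
    (g := fun x => φ x / m) ((hcont.aemeasurable hU.measurableSet).div_const m)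
    ((ae_restrict_mem hU.measurableSet).mono hg1)
    (fun s => by
      rw [Measure.restrict_apply' hU.measurableSet, hlevel]
      exact hfin _)
    (fun s t hs hst => by
      rw [measureReal_restrict_apply' hU.measurableSet, hlevel,
        measureReal_restrict_apply' hU.measurableSet, hlevel]
      have h := hconv.volume_sublevel_le hfin hm hinf (lt_mul_of_one_lt_right hm0 hs)
        (mul_lt_mul_of_pos_left hst hm0)
      rw [show m * s - m = m * (s - 1) by ring, show m * t - m = m * (t - 1) by ring, mul_pow,
        mul_pow] at h
      refine le_of_mul_le_mul_left ?_ (pow_pos hm0 n)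
      linarith)
  obtain ⟨hone, hent⟩ := neg_integral_mul_log_eq hU.measurableSet hM0 hg1
    (fun x hx => by
      rw [hfφ, Real.div_rpow (hpos x hx).le hm0.le, mul_div_cancel₀ _ hM0.ne'])
    hf0
    (by
      rw [integral_eq_lintegral_of_nonneg_ae (ae_of_all _ hf_nonneg)
        (hfcont.aestronglyMeasurable hU.measurableSet), hU_one, ENNReal.toReal_one])
    hi hil
  rw [hent, hess]
  gcongr
  calc m ^ (-β) * ∫ x in U, (φ x / m) ^ (-β) * log (φ x / m)
      ≤ m ^ (-β) * ((∑ i ∈ Finset.Icc 1 n, (β - (i : ℝ))⁻¹)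
        * ∫ x in U, (φ x / m) ^ (-β)) := by gcongr
    _ = _ := by rw [mul_left_comm, hone, mul_one]

theorem volume_orthant_sublevel {n : ℕ} {a : ℝ} (ha : 0 < a) {s : ℝ} (hs : 1 < s) :
    volume.real {x : Fin n → ℝ | (∀ i, 0 < x i) ∧ (a + ∑ i, x i) / a < s}
      = volume.real {x : Fin n → ℝ | (∀ i, 0 < x i) ∧ ∑ i, x i < a} * (s - 1) ^ n := by
  have hs0 : 0 < s - 1 := by linarith
  have hset : {x : Fin n → ℝ | (∀ i, 0 < x i) ∧ (a + ∑ i, x i) / a < s}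
      = (s - 1) • {x : Fin n → ℝ | (∀ i, 0 < x i) ∧ ∑ i, x i < a} := by
    ext x
    rw [mem_smul_set_iff_inv_smul_mem₀ hs0.ne']
    simp only [mem_ofPred_eq, Pi.smul_apply, smul_eq_mul, ← Finset.mul_sum]
    refine and_congr (forall_congr' fun i => ?_) ?_
    · rw [mul_pos_iff_of_pos_left (inv_pos.mpr hs0)]
    · rw [div_lt_iff₀ ha, inv_mul_lt_iff₀ hs0]
      constructor <;> intro h <;> linarith
  rw [hset, measureReal_def, Measure.addHaar_smul, Module.finrank_fin_fun, ENNReal.toReal_mul,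
    ENNReal.toReal_ofReal (abs_nonneg _), abs_of_nonneg (by positivity), mul_comm, measureReal_def]

theorem volume_orthant_sublevel_ne_top {n : ℕ} {a : ℝ} (ha : 0 < a) (s : ℝ) :
    volume {x : Fin n → ℝ | (∀ i, 0 < x i) ∧ (a + ∑ i, x i) / a < s} ≠ ⊤ := by
  have hbox : volume (Icc (0 : Fin n → ℝ) fun _ => a * s - a) ≠ ⊤ := isCompact_Icc.measure_ne_top
  refine measure_ne_top_of_subset (fun x hx => ?_) hbox
  refine ⟨fun i => (hx.1 i).le, fun i => ?_⟩
  have h1 : x i ≤ ∑ j, x j := Finset.single_le_sum (fun j _ => (hx.1 j).le) (Finset.mem_univ i)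
  have h2 := (div_lt_iff₀ ha).mp hx.2
  change x i ≤ a * s - a
  linarith

theorem entropy_pareto {n : ℕ} {β : ℝ} (hβ : (n : ℝ) < β) {a : ℝ} (ha : 0 < a)
    {f : (Fin n → ℝ) → ℝ}
    (hf : ∀ x, f x = if ∀ i, 0 < x i then
      (a + ∑ i, x i) ^ (-β) / (∫ y in {y : Fin n → ℝ | ∀ i, 0 < y i}, (a + ∑ i, y i) ^ (-β))
      else 0) :
    (-∫ x, f x * log (f x))
      = -log (essSup f volume) + β * ∑ i ∈ Finset.Icc 1 n, (β - (i : ℝ))⁻¹ := by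
  have hβ0 : 0 < β := lt_of_le_of_lt n.cast_nonneg hβ
  set U : Set (Fin n → ℝ) := {y | ∀ i, 0 < y i} with hUdef
  set g : (Fin n → ℝ) → ℝ := fun x => (a + ∑ i, x i) / a with hgdef
  have hU : IsOpen U := by
    have : U = ⋂ i, {y | 0 < y i} := by ext; simp [hUdef]
    rw [this]
    exact isOpen_iInter_of_finite fun i => isOpen_lt continuous_const (continuous_apply i)
  have hg : Continuous g := by fun_prop
  have hg1 : ∀ x ∈ U, 1 ≤ g x := fun x hx => by
    have : 0 ≤ ∑ i, x i := Finset.sum_nonneg fun i _ => (hx i).le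
    exact (one_le_div ha).mpr (by linarith)
  have hlevel : ∀ s, {x | g x < s} ∩ U = {x | (∀ i, 0 < x i) ∧ (a + ∑ i, x i) / a < s} :=
    fun s => by
      ext x
      simp [hUdef, hgdef, and_comm]
  obtain ⟨hi, hil, heq⟩ := integral_rpow_mul_log_eq (μ := volume.restrict U) hβ
    hg.aemeasurable ((ae_restrict_mem hU.measurableSet).mono hg1)
    (fun s => by
      rw [Measure.restrict_apply' hU.measurableSet, hlevel]
      exact volume_orthant_sublevel_ne_top ha s)
    (fun s hs => by
      rw [measureReal_restrict_apply' hU.measurableSet, hlevel]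
      exact volume_orthant_sublevel ha hs)
  have hag : ∀ x ∈ U, (a + ∑ i, x i) ^ (-β) = a ^ (-β) * g x ^ (-β) := fun x hx => by
    rw [← Real.mul_rpow ha.le (zero_le_one.trans (hg1 x hx)), hgdef]
    congr 1
    field_simp
  have haβ : 0 < a ^ (-β) := by positivity
  set Z := ∫ y in U, (a + ∑ i, y i) ^ (-β) with hZdef
  have hZg : Z = a ^ (-β) * ∫ x in U, g x ^ (-β) := by
    rw [hZdef, ← integral_const_mul]
    exact setIntegral_congr_fun hU.measurableSet hag
  have hZ : 0 < Z := by
    rw [hZg]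
    refine mul_pos haβ ?_
    rw [setIntegral_pos_iff_support_of_nonneg_ae ?_ hi]
    · have hsub : U ⊆ Function.support (fun x => g x ^ (-β)) ∩ U := fun x hx =>
        ⟨(Real.rpow_pos_of_pos (one_pos.trans_le (hg1 x hx)) _).ne', hx⟩
      exact (hU.measure_pos volume ⟨1, fun i => one_pos⟩).trans_le (measure_mono hsub)
    · filter_upwards [ae_restrict_mem hU.measurableSet] with x hx
      have := hg1 x hx
      exact Real.rpow_nonneg (by linarith) _
  have hM0 : 0 < a ^ (-β) / Z := by positivity
  have hfU : ∀ x ∈ U, f x = a ^ (-β) / Z * g x ^ (-β) := fun x hx => by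
    rw [hf, if_pos (show ∀ i, 0 < x i from hx), hag x hx]
    ring
  have hf0 : ∀ x, x ∉ U → f x = 0 := fun x hx => by rw [hf, if_neg (show ¬∀ i, 0 < x i from hx)]
  have hess : essSup f volume = a ^ (-β) / Z := by
    refine essSup_eq_of_isOpen hU ?_ (ae_of_all _ fun x => ?_) fun δ hδ => ?_
    · refine ContinuousOn.congr (f := fun x => a ^ (-β) / Z * g x ^ (-β)) ?_ hfU
      refine continuousOn_const.mul (hg.continuousOn.rpow_const fun x hx => Or.inl ?_)
      exact (one_pos.trans_le (hg1 x hx)).ne'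
    · by_cases h : x ∈ U
      · rw [hfU x h]
        exact mul_le_of_le_one_right hM0.le
          (Real.rpow_le_one_of_one_le_of_nonpos (hg1 x h) (by linarith))
      · rw [hf0 x h]
        exact hM0.le
    · have hlim : Tendsto (fun t : ℝ => a ^ (-β) / Z * g (fun _ => t) ^ (-β)) (𝓝[>] 0)
          (𝓝 (a ^ (-β) / Z)) := by
        have hg0 : g (fun _ => 0) = 1 := by simp [hgdef, ha.ne']
        have h : ContinuousAt (fun t : ℝ => a ^ (-β) / Z * g (fun _ => t) ^ (-β)) 0 := by
          refine continuousAt_const.mul (ContinuousAt.rpow_const ?_ (Or.inl ?_))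
          · exact (hg.comp (by fun_prop)).continuousAt
          · rw [hg0]
            exact one_ne_zero
        have h' := h.tendsto
        rw [hg0, Real.one_rpow, mul_one] at h'
        exact h'.mono_left nhdsWithin_le_nhds
      obtain ⟨t, ht, ht0⟩ := ((hlim.eventually_const_lt hδ).and self_mem_nhdsWithin).exists
      have hmem : (fun _ => t) ∈ U := fun _ => ht0
      exact ⟨_, hmem, by rwa [hfU _ hmem]⟩
  have hone : ∫ x in U, f x = 1 := by
    rw [setIntegral_congr_fun hU.measurableSet hfU, integral_const_mul, div_mul_eq_mul_div,
      ← hZg, div_self hZ.ne']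
  obtain ⟨hone', hent⟩ := neg_integral_mul_log_eq hU.measurableSet hM0 hg1 hfU
    (ae_of_all _ hf0) hone hi hil
  rw [hent, hess, heq, mul_left_comm (a ^ (-β) / Z), hone', mul_one]

/-- Let `β > n` and let `X` be a random vector in `ℝⁿ` with `(-1/β)`-concave
density `f`. Then `h(X) = -∫ f log f ≤ -log ‖f‖_∞ + β ∑_{i=1}^n (β-i)⁻¹`, with equality for
the Pareto densities `Z⁻¹(a + x₁ + ⋯ + xₙ)^{-β}` on the positive orthant. -/
theorem stmt16
    {Ω : Type*} [MeasureSpace Ω] [IsProbabilityMeasure (ℙ : Measure Ω)]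
    (n : ℕ) (β : ℝ) (hβ : (n : ℝ) < β)
    (X : Ω → (Fin n → ℝ)) (hX : Measurable X)
    (f : (Fin n → ℝ) → ℝ) (hf_nonneg : ∀ x, 0 ≤ f x)
    (hf_density : Measure.map X ℙ = volume.withDensity (fun x => ENNReal.ofReal (f x)))
    (hf_conv : ConvexOn ℝ {x | 0 < f x} (fun x => f x ^ (-1 / β))) :
    (-∫ x, f x * Real.log (f x))
        ≤ -Real.log (essSup f volume) + β * ∑ i ∈ Finset.Icc 1 n, (β - (i : ℝ))⁻¹ ∧
    ∀ a : ℝ, 0 < a →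
      ((fun fPar : (Fin n → ℝ) → ℝ =>
          (-∫ x, fPar x * Real.log (fPar x))
            = -Real.log (essSup fPar volume)
                + β * ∑ i ∈ Finset.Icc 1 n, (β - (i : ℝ))⁻¹)
        (fun x => if ∀ i, 0 < x i then
            (a + ∑ i, x i) ^ (-β)
              / (∫ y in {y : Fin n → ℝ | ∀ i, 0 < y i}, (a + ∑ i, y i) ^ (-β))
          else 0)) := by
  refine ⟨entropy_le_of_convexOn hβ hf_nonneg ?_ hf_conv,
    fun a ha => entropy_pareto hβ ha fun x => rfl⟩
  rw [← setLIntegral_univ, ← withDensity_apply _ MeasurableSet.univ, ← hf_density,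
    Measure.map_apply hX MeasurableSet.univ, preimage_univ, measure_univ]
end

section
/- Let β > n and let X be a random vector in ℝⁿ with (-1/β)-concave density f. Almost surely, -log f(X) - h(X) ≥ -β ∑_{i=1}^n (β - i)^{-1}; equivalently, f(X) ≤ ‖f‖_∞ almost surely implies h(X) + log f(X) ≤ β ∑_{i=1}^n (β-i)^{-1} almost surely. -/
open MeasureTheory ProbabilityTheory Real

theorem hasDerivAt_rpow_neg_mul_log {b u : ℝ} (hb : b ≠ 0) (hu : 0 < u) :
    HasDerivAt (fun u : ℝ => -(u ^ (-b) * log u / b) - u ^ (-b) / b ^ 2)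
      (u ^ (-b - 1) * log u) u := by
  have h1 : HasDerivAt (fun u : ℝ => u ^ (-b)) (-b * u ^ (-b - 1)) u :=
    Real.hasDerivAt_rpow_const (Or.inl hu.ne')
  have h2 := ((((h1.mul (Real.hasDerivAt_log hu.ne')).div_const b).neg).sub
    (h1.div_const (b ^ 2)))
  refine h2.congr_deriv ?_
  have h3 : u ^ (-b) = u ^ (-b - 1) * u := by
    rw [← Real.rpow_add_one hu.ne']; ring_nf
  rw [h3]
  field_simp
  ring

theorem tendsto_rpow_neg_mul_log_atTop {b : ℝ} (hb : 0 < b) :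
    Filter.Tendsto (fun u : ℝ => u ^ (-b) * log u) Filter.atTop (nhds 0) := by
  have h := (isLittleO_log_rpow_atTop hb).tendsto_div_nhds_zero
  refine h.congr' ?_
  filter_upwards [Filter.eventually_gt_atTop 0] with u hu
  rw [Real.rpow_neg hu.le, div_eq_inv_mul]

theorem tendsto_antideriv_rpow_neg_mul_log {b : ℝ} (hb : 0 < b) :
    Filter.Tendsto (fun u : ℝ => -(u ^ (-b) * log u / b) - u ^ (-b) / b ^ 2)
      Filter.atTop (nhds 0) := by
  simpa using (((tendsto_rpow_neg_mul_log_atTop hb).div_const b).neg).sub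
    ((tendsto_rpow_neg_atTop hb).div_const (b ^ 2))

theorem integrableOn_Ioi_rpow_neg_mul_log {b c : ℝ} (hb : 0 < b) (hc : 0 < c) :
    IntegrableOn (fun u : ℝ => u ^ (-b - 1) * log u) (Set.Ioi c) := by
  have h1 : IntegrableOn (fun u : ℝ => u ^ (-b - 1) * log u) (Set.Ioi 1) :=
    integrableOn_Ioi_deriv_of_nonneg'
      (fun u hu => hasDerivAt_rpow_neg_mul_log hb.ne' (zero_lt_one.trans_le hu))
      (fun u hu => mul_nonneg (Real.rpow_nonneg (zero_lt_one.trans hu).le _)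
        (Real.log_nonneg (le_of_lt hu)))
      (tendsto_antideriv_rpow_neg_mul_log hb)
  have h2 : IntegrableOn (fun u : ℝ => u ^ (-b - 1) * log u) (Set.Icc c 1) := by
    refine ContinuousOn.integrableOn_Icc fun u hu => ContinuousAt.continuousWithinAt ?_
    have hu0 : u ≠ 0 := (hc.trans_le hu.1).ne'
    exact (Real.continuousAt_rpow_const _ _ (Or.inl hu0)).mul (Real.continuousAt_log hu0)
  refine (h2.union h1).mono_set fun u hu => ?_
  rcases le_or_gt u 1 with h | h
  · exact Or.inl ⟨le_of_lt hu, h⟩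
  · exact Or.inr h

theorem integral_Ioi_rpow_neg_mul_log {b c : ℝ} (hb : 0 < b) (hc : 0 < c) :
    ∫ u in Set.Ioi c, u ^ (-b - 1) * log u = c ^ (-b) * log c / b + c ^ (-b) / b ^ 2 := by
  rw [integral_Ioi_of_hasDerivAt_of_tendsto'
    (fun u hu => hasDerivAt_rpow_neg_mul_log hb.ne' (hc.trans_le hu))
    (integrableOn_Ioi_rpow_neg_mul_log hb hc) (tendsto_antideriv_rpow_neg_mul_log hb)]
  ring

theorem integrableOn_Ioi_rpow_neg_sub_one {b c : ℝ} (hb : 0 < b) (hc : 0 < c) :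
    IntegrableOn (fun u : ℝ => u ^ (-b - 1)) (Set.Ioi c) :=
  integrableOn_Ioi_rpow_of_lt (by linarith) hc

theorem integral_Ioi_rpow_neg_sub_one {b c : ℝ} (hb : 0 < b) (hc : 0 < c) :
    ∫ u in Set.Ioi c, u ^ (-b - 1) = c ^ (-b) / b := by
  rw [integral_Ioi_rpow_of_lt (by linarith) hc, sub_add_cancel, neg_div_neg_eq]

/-- The beta integral `∫₁^∞ (u - 1)ⁿ u^{-β-1} du`, together with its logarithmic variant. -/
theorem integral_Ioi_one_sub_one_pow (n : ℕ) : ∀ β : ℝ, (n : ℝ) < β →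
    IntegrableOn (fun u : ℝ => (u - 1) ^ n * u ^ (-β - 1)) (Set.Ioi 1) ∧
    IntegrableOn (fun u : ℝ => (u - 1) ^ n * (u ^ (-β - 1) * log u)) (Set.Ioi 1) ∧
    ∫ u in Set.Ioi (1 : ℝ), (u - 1) ^ n * u ^ (-β - 1) =
      n.factorial / ∏ i ∈ Finset.range (n + 1), (β - i) ∧
    ∫ u in Set.Ioi (1 : ℝ), (u - 1) ^ n * (u ^ (-β - 1) * log u) =
      n.factorial / (∏ i ∈ Finset.range (n + 1), (β - i)) *
        ∑ i ∈ Finset.range (n + 1), (β - (i : ℝ))⁻¹ := by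
  induction n with
  | zero =>
    intro β hβ
    have hβ' : 0 < β := by simpa using hβ
    simp only [pow_zero, one_mul]
    refine ⟨integrableOn_Ioi_rpow_neg_sub_one hβ' one_pos,
      integrableOn_Ioi_rpow_neg_mul_log hβ' one_pos, ?_, ?_⟩
    · rw [integral_Ioi_rpow_neg_sub_one hβ' one_pos]; simp
    · rw [integral_Ioi_rpow_neg_mul_log hβ' one_pos]; simp; field_simp
  | succ n ih =>
    intro β hβ
    push_cast at hβ
    obtain ⟨i1, l1, I1, L1⟩ := ih (β - 1) (by linarith)
    obtain ⟨i2, l2, I2, L2⟩ := ih β (by linarith)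
    have key : ∀ u ∈ Set.Ioi (1 : ℝ), (u - 1) ^ (n + 1) * u ^ (-β - 1) =
        (u - 1) ^ n * u ^ (-(β - 1) - 1) - (u - 1) ^ n * u ^ (-β - 1) := by
      intro u hu
      have hu0 : u ≠ 0 := (zero_lt_one.trans hu).ne'
      have : u ^ (-(β - 1) - 1) = u ^ (-β - 1) * u := by
        rw [← Real.rpow_add_one hu0]; ring_nf
      rw [this]; ring
    have keyl : ∀ u ∈ Set.Ioi (1 : ℝ), (u - 1) ^ (n + 1) * (u ^ (-β - 1) * log u) =
        (u - 1) ^ n * (u ^ (-(β - 1) - 1) * log u) - (u - 1) ^ n * (u ^ (-β - 1) * log u) := by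
      intro u hu
      linear_combination (key u hu) * log u
    have hprod : ∏ i ∈ Finset.range (n + 1), (β - 1 - (i : ℝ)) =
        ∏ i ∈ Finset.range (n + 1), (β - ((i + 1 : ℕ) : ℝ)) :=
      Finset.prod_congr rfl fun i _ => by push_cast; ring
    have hsum : ∑ i ∈ Finset.range (n + 1), (β - 1 - (i : ℝ))⁻¹ =
        ∑ i ∈ Finset.range (n + 1), (β - ((i + 1 : ℕ) : ℝ))⁻¹ :=
      Finset.sum_congr rfl fun i _ => by push_cast; ring
    have hP1 := Finset.prod_range_succ (fun i : ℕ => β - (i : ℝ)) (n + 1)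
    have hP2 := Finset.prod_range_succ' (fun i : ℕ => β - (i : ℝ)) (n + 1)
    have hS1 := Finset.sum_range_succ (fun i : ℕ => (β - (i : ℝ))⁻¹) (n + 1)
    have hS2 := Finset.sum_range_succ' (fun i : ℕ => (β - (i : ℝ))⁻¹) (n + 1)
    have hpos : ∀ k ≤ n + 1, 0 < ∏ i ∈ Finset.range (k + 1), (β - (i : ℝ)) := by
      intro k hk
      refine Finset.prod_pos fun i hi => ?_
      have : (i : ℝ) ≤ n + 1 := by
        exact_mod_cast (Nat.lt_succ_iff.mp (Finset.mem_range.mp hi)).trans hk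
      linarith
    have p0 := hpos n (by omega)
    have p1 := hpos (n + 1) le_rfl
    rw [hprod] at I1 L1
    rw [hsum] at L1
    have hβ0 : 0 < β := by have := n.cast_nonneg (α := ℝ); linarith
    have hβn : 0 < β - ((n + 1 : ℕ) : ℝ) := by push_cast; linarith
    simp only [Nat.cast_zero, sub_zero] at hP2 hS2
    set A := ∏ i ∈ Finset.range (n + 1 + 1), (β - (i : ℝ))
    set B := ∏ i ∈ Finset.range (n + 1), (β - (i : ℝ))
    set C := ∏ i ∈ Finset.range (n + 1), (β - ((i + 1 : ℕ) : ℝ))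
    set T := ∑ i ∈ Finset.range (n + 1 + 1), (β - (i : ℝ))⁻¹
    have hB : B = A / (β - ((n + 1 : ℕ) : ℝ)) := by rw [hP1]; field_simp
    have hC : C = A / β := by rw [hP2]; field_simp
    have eI : ∫ u in Set.Ioi (1 : ℝ), (u - 1) ^ (n + 1) * u ^ (-β - 1) =
        n.factorial / C - n.factorial / B := by
      rw [setIntegral_congr_fun measurableSet_Ioi key, integral_sub i1 i2, I1, I2]
    have eL : ∫ u in Set.Ioi (1 : ℝ), (u - 1) ^ (n + 1) * (u ^ (-β - 1) * log u) =
        n.factorial / C * (T - β⁻¹) - n.factorial / B * (T - (β - ((n + 1 : ℕ) : ℝ))⁻¹) := by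
      rw [setIntegral_congr_fun measurableSet_Ioi keyl, integral_sub l1 l2, L1, L2]
      congr 2
      · rw [hS2]; ring
      · rw [hS1]; ring
    refine ⟨(integrableOn_congr_fun key measurableSet_Ioi).mpr (i1.sub i2),
      (integrableOn_congr_fun keyl measurableSet_Ioi).mpr (l1.sub l2), ?_, ?_⟩
    · rw [eI, hB, hC, Nat.factorial_succ]
      push_cast at hβn ⊢
      field_simp
      ring
    · rw [eL, hB, hC, Nat.factorial_succ]
      push_cast at hβn ⊢
      field_simp
      ring

/-- The function `-q'` for `q u = u^{-β} (S - log u)` with `S = ∑_{i=1}^n (β - i)⁻¹` is orthogonal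
to `(u - 1)ⁿ` on `(1, ∞)`. -/
theorem integral_Ioi_one_kernel_eq_zero (n : ℕ) {β : ℝ} (hβ : (n : ℝ) < β) :
    IntegrableOn (fun u : ℝ => (u - 1) ^ n * (u ^ (-β - 1) *
      (β * ∑ i ∈ Finset.Icc 1 n, (β - (i : ℝ))⁻¹ + 1 - β * log u))) (Set.Ioi 1) ∧
    ∫ u in Set.Ioi (1 : ℝ), (u - 1) ^ n * (u ^ (-β - 1) *
      (β * ∑ i ∈ Finset.Icc 1 n, (β - (i : ℝ))⁻¹ + 1 - β * log u)) = 0 := by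
  obtain ⟨i1, l1, I1, L1⟩ := integral_Ioi_one_sub_one_pow n β hβ
  set S := ∑ i ∈ Finset.Icc 1 n, (β - (i : ℝ))⁻¹ with hS
  have hβ0 : 0 < β := (Nat.cast_nonneg n).trans_lt hβ
  have hT : ∑ i ∈ Finset.range (n + 1), (β - (i : ℝ))⁻¹ = S + β⁻¹ := by
    rw [Finset.sum_range_succ', hS, ← Finset.Ico_add_one_right_eq_Icc, Finset.sum_Ico_eq_sum_range]
    simp [add_comm]
  have hfun : (fun u : ℝ => (u - 1) ^ n * (u ^ (-β - 1) * (β * S + 1 - β * log u))) =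
      fun u => (β * S + 1) * ((u - 1) ^ n * u ^ (-β - 1)) -
        β * ((u - 1) ^ n * (u ^ (-β - 1) * log u)) := by
    funext u; ring
  rw [hfun]
  refine ⟨(i1.const_mul _).sub (l1.const_mul _), ?_⟩
  rw [integral_sub (i1.const_mul _) (l1.const_mul _), integral_const_mul, integral_const_mul,
    I1, L1, hT]
  field_simp
  ring

/-- A measure `ν` on `(0, ∞)` for which `u ↦ ν (-∞, u) / (u - 1)ⁿ` is antitone on `(1, ∞)` has a
`v^{-β}`-weighted logarithmic moment of at most `∑_{i=1}^n (β - i)⁻¹`. -/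
theorem integral_rpow_neg_mul_log_le (ν : Measure ℝ) [SFinite ν] (n : ℕ) {β c : ℝ}
    (hβ : (n : ℝ) < β) (hc : 0 < c) (hc1 : c ≤ 1) (hν : ν (Set.Iio c) = 0) (hfin : ∀ u, ν (Set.Iio u) ≠ ⊤)
    (hscale : ∀ t u : ℝ, 0 < t → t ≤ 1 → 1 < u →
      t ^ n * ν.real (Set.Iio u) ≤ ν.real (Set.Iio (1 - t + t * u))) :
    Integrable (fun v : ℝ => v ^ (-β) * (∑ i ∈ Finset.Icc 1 n, (β - (i : ℝ))⁻¹ - log v)) ν ∧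
    0 ≤ ∫ v, v ^ (-β) * (∑ i ∈ Finset.Icc 1 n, (β - (i : ℝ))⁻¹ - log v) ∂ν := by
  obtain ⟨K1, K0⟩ := integral_Ioi_one_kernel_eq_zero n hβ
  have hS0 : 0 ≤ ∑ i ∈ Finset.Icc 1 n, (β - (i : ℝ))⁻¹ := by
    refine Finset.sum_nonneg fun i hi => inv_nonneg.mpr ?_
    have : (i : ℝ) ≤ n := by exact_mod_cast (Finset.mem_Icc.mp hi).2
    linarith
  set S := ∑ i ∈ Finset.Icc 1 n, (β - (i : ℝ))⁻¹
  have hβ0 : 0 < β := (Nat.cast_nonneg n).trans_lt hβ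
  set p : ℝ → ℝ := fun u => u ^ (-β - 1) * (β * S + 1 - β * log u) with hp
  set W : ℝ → ℝ := fun u => ν.real (Set.Iio u)
  have hpm : Measurable p := by fun_prop
  have hWmono : Monotone W := fun u v huv =>
    measureReal_mono (Set.Iio_subset_Iio huv) (hfin v)
  have hW0 : ∀ u, 0 ≤ W u := fun u => measureReal_nonneg
  -- the tail integrals of the kernel
  have hpint : ∀ v, 0 < v → IntegrableOn p (Set.Ioi v) := by
    intro v hv
    have : p = fun u => (β * S + 1) * u ^ (-β - 1) - β * (u ^ (-β - 1) * log u) := by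
      funext u; simp only [hp]; ring
    rw [this]
    exact ((integrableOn_Ioi_rpow_neg_sub_one hβ0 hv).const_mul _).sub
      ((integrableOn_Ioi_rpow_neg_mul_log hβ0 hv).const_mul _)
  have hptail : ∀ v, 0 < v → ∫ u in Set.Ioi v, p u = v ^ (-β) * (S - log v) := by
    intro v hv
    have : p = fun u => (β * S + 1) * u ^ (-β - 1) - β * (u ^ (-β - 1) * log u) := by
      funext u; simp only [hp]; ring
    rw [this, integral_sub ((integrableOn_Ioi_rpow_neg_sub_one hβ0 hv).const_mul _)
      ((integrableOn_Ioi_rpow_neg_mul_log hβ0 hv).const_mul _), integral_const_mul,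
      integral_const_mul, integral_Ioi_rpow_neg_sub_one hβ0 hv,
      integral_Ioi_rpow_neg_mul_log hβ0 hv]
    field_simp
    ring
  -- comparison of `W` with a multiple of `(u - 1) ^ n` at the sign change of the kernel
  set m : ℝ := exp (S + β⁻¹)
  have hm1 : 1 < m := Real.one_lt_exp_iff.mpr (by positivity)
  have hm1' : 0 < m - 1 := sub_pos.mpr hm1
  set w : ℝ := W m / (m - 1) ^ n with hw
  have hw0 : 0 ≤ w := div_nonneg (hW0 m) (by positivity)
  have hlow : ∀ u, 1 < u → u ≤ m → w * (u - 1) ^ n ≤ W u := by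
    intro u hu hum
    have hu' : 0 < u - 1 := sub_pos.mpr hu
    have h := hscale ((u - 1) / (m - 1)) m (by positivity)
      ((div_le_one hm1').mpr (by linarith)) hm1
    have e : 1 - (u - 1) / (m - 1) + (u - 1) / (m - 1) * m = u := by field_simp; ring
    rw [e, div_pow] at h
    calc w * (u - 1) ^ n = (u - 1) ^ n / (m - 1) ^ n * W m := by rw [hw]; ring
      _ ≤ W u := h
  have hupp : ∀ u, m ≤ u → W u ≤ w * (u - 1) ^ n := by
    intro u hum
    have hu' : 0 < u - 1 := by linarith
    have h := hscale ((m - 1) / (u - 1)) u (by positivity)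
      ((div_le_one hu').mpr (by linarith)) (by linarith)
    have e : 1 - (m - 1) / (u - 1) + (m - 1) / (u - 1) * u = m := by field_simp; ring
    rw [e, div_pow, div_mul_eq_mul_div, div_le_iff₀ (by positivity)] at h
    rw [hw, div_mul_eq_mul_div, le_div_iff₀ (by positivity), mul_comm]
    exact h
  have hppos : ∀ u, 0 < u → u ≤ m → 0 ≤ p u := by
    intro u hu hum
    have : log u ≤ S + β⁻¹ := by rw [← Real.log_exp (S + β⁻¹)]; exact Real.log_le_log hu hum
    have h2 := mul_le_mul_of_nonneg_left this hβ0.le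
    rw [mul_add, mul_inv_cancel₀ hβ0.ne'] at h2
    exact mul_nonneg (Real.rpow_nonneg hu.le _) (by linarith)
  have hpneg : ∀ u, m ≤ u → p u ≤ 0 := by
    intro u hum
    have : S + β⁻¹ ≤ log u := by
      rw [← Real.log_exp (S + β⁻¹)]; exact Real.log_le_log (Real.exp_pos _) hum
    have h2 := mul_le_mul_of_nonneg_left this hβ0.le
    rw [mul_add, mul_inv_cancel₀ hβ0.ne'] at h2
    exact mul_nonpos_of_nonneg_of_nonpos (Real.rpow_nonneg (by linarith) _) (by linarith)
  -- integrability of `p * W`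
  have hpWint : IntegrableOn (fun u => p u * W u) (Set.Ioi c) := by
    have h1 : IntegrableOn (fun u => W m * ‖p u‖ +
        Set.indicator (Set.Ioi 1) (fun u => w * ‖(u - 1) ^ n * p u‖) u) (Set.Ioi c) := by
      refine ((hpint c hc).norm.const_mul _).add ?_
      exact ((integrable_indicator_iff measurableSet_Ioi).mpr
        (K1.norm.const_mul w)).integrableOn
    refine h1.mono' (hpm.mul hWmono.measurable).aestronglyMeasurable ?_
    refine Filter.Eventually.of_forall fun u => ?_
    rw [norm_mul, Real.norm_of_nonneg (hW0 u)]
    rcases le_total u m with h | h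
    · have h2 : 0 ≤ Set.indicator (Set.Ioi 1) (fun u => w * ‖(u - 1) ^ n * p u‖) u :=
        Set.indicator_nonneg (fun u _ => by positivity) u
      nlinarith [hWmono h, norm_nonneg (p u)]
    · rw [Set.indicator_of_mem (Set.mem_Ioi.mpr (hm1.trans_le h)),
        norm_mul ((u - 1) ^ n), Real.norm_of_nonneg (pow_nonneg (by linarith) n : (0 : ℝ) ≤ (u - 1) ^ n)]
      have h3 := mul_le_mul_of_nonneg_left (hupp u h) (norm_nonneg (p u))
      have h4 := mul_nonneg (hW0 m) (norm_nonneg (p u))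
      linarith
  have hpW : 0 ≤ ∫ u in Set.Ioi c, p u * W u := by
    have h1 : IntegrableOn (Set.indicator (Set.Ioi 1) (fun u => w * ((u - 1) ^ n * p u)))
        (Set.Ioi c) :=
      ((integrable_indicator_iff measurableSet_Ioi).mpr (K1.const_mul w)).integrableOn
    have h2 : ∫ u in Set.Ioi c, Set.indicator (Set.Ioi 1) (fun u => w * ((u - 1) ^ n * p u)) u
        = 0 := by
      rw [setIntegral_indicator measurableSet_Ioi, Set.Ioi_inter_Ioi, sup_eq_right.mpr hc1,
        integral_const_mul, K0, mul_zero]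
    rw [← h2]
    refine setIntegral_mono_on h1 hpWint measurableSet_Ioi fun u hu => ?_
    have hu0 : 0 < u := hc.trans hu
    rcases le_or_gt u 1 with h | h
    · rw [Set.indicator_of_notMem (by simpa using h)]
      exact mul_nonneg (hppos u hu0 (h.trans hm1.le)) (hW0 u)
    · rw [Set.indicator_of_mem (Set.mem_Ioi.mpr h)]
      rcases le_total u m with h' | h'
      · nlinarith [mul_le_mul_of_nonneg_left (hlow u h h') (hppos u hu0 h')]
      · nlinarith [mul_le_mul_of_nonpos_left (hupp u h') (hpneg u h')]
  -- Fubini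
  set F : ℝ → ℝ → ℝ := fun v u => Set.indicator (Set.Ioi v) p u with hF
  have hFm : Measurable (Function.uncurry F) := by
    have : Function.uncurry F = Set.indicator {z : ℝ × ℝ | z.1 < z.2} (fun z => p z.2) := by
      funext ⟨v, u⟩
      simp [hF, Function.uncurry, Set.indicator]
    rw [this]
    exact (hpm.comp measurable_snd).indicator (measurableSet_lt measurable_fst measurable_snd)
  have hFsec : ∀ u, (fun v => F v u) = Set.indicator (Set.Iio u) (fun _ => p u) := by
    intro u; funext v; simp [hF, Set.indicator]
  have hFint : Integrable (Function.uncurry F) (ν.prod (volume.restrict (Set.Ioi c))) := by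
    rw [integrable_prod_iff' hFm.aestronglyMeasurable]
    constructor
    · refine Filter.Eventually.of_forall fun u => ?_
      change Integrable (fun v => F v u) ν
      rw [hFsec, integrable_indicator_iff measurableSet_Iio]
      exact integrableOn_const (hfin u)
    · refine hpWint.norm.congr (Filter.Eventually.of_forall fun u => ?_)
      change ‖p u * W u‖ = ∫ v, ‖F v u‖ ∂ν
      have : (fun v => ‖F v u‖) = Set.indicator (Set.Iio u) (fun _ => ‖p u‖) := by
        funext v; rw [congrFun (hFsec u) v, norm_indicator_eq_indicator_norm]
      rw [this, integral_indicator measurableSet_Iio, setIntegral_const, norm_mul,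
        Real.norm_of_nonneg (hW0 u), smul_eq_mul, mul_comm]
  have hinner : ∀ᵐ v ∂ν, ∫ u in Set.Ioi c, F v u = v ^ (-β) * (S - log v) := by
    have : ∀ᵐ v ∂ν, ¬ v < c := measure_eq_zero_iff_ae_notMem.mp hν
    filter_upwards [this] with v hv
    rw [not_lt] at hv
    rw [← hptail v (hc.trans_le hv)]
    simp only [hF]
    rw [setIntegral_indicator measurableSet_Ioi, Set.Ioi_inter_Ioi, sup_eq_right.mpr hv]
  refine ⟨hFint.integral_prod_left.congr hinner, ?_⟩
  rw [← integral_congr_ae hinner, integral_integral_swap hFint]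
  refine hpW.trans_eq (integral_congr_ae (Filter.Eventually.of_forall fun u => ?_))
  change p u * W u = ∫ v, F v u ∂ν
  rw [hFsec, integral_indicator measurableSet_Iio, setIntegral_const, smul_eq_mul, mul_comm]

/-- Sublevel sets of a convex function shrink at most like `tⁿ` under contraction by `t` towards a
point of the domain. -/
theorem ConvexOn.pow_mul_volume_sublevel_le {n : ℕ} {K : Set (Fin n → ℝ)} {φ : (Fin n → ℝ) → ℝ}
    (hφ : ConvexOn ℝ K φ) {y : Fin n → ℝ} (hy : y ∈ K) {t : ℝ} (ht : 0 < t) (ht1 : t ≤ 1)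
    (u : ℝ) :
    ENNReal.ofReal (t ^ n) * volume {x | x ∈ K ∧ φ x < u} ≤
      volume {x | x ∈ K ∧ φ x < (1 - t) * φ y + t * u} := by
  have h := Measure.addHaar_image_homothety (volume : Measure (Fin n → ℝ)) y t
    {x | x ∈ K ∧ φ x < u}
  rw [Module.finrank_fin_fun, abs_of_nonneg (by positivity)] at h
  rw [← h]
  refine measure_mono ?_
  rintro _ ⟨x, ⟨hxK, hxu⟩, rfl⟩
  have e : AffineMap.homothety y t x = (1 - t) • y + t • x := by
    rw [AffineMap.homothety_apply, vsub_eq_sub, vadd_eq_add]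
    module
  rw [e]
  have h1t : 0 ≤ 1 - t := by linarith
  refine ⟨hφ.1 hy hxK h1t ht.le (by ring), ?_⟩
  have := hφ.2 hy hxK h1t ht.le (by ring)
  simp only [smul_eq_mul] at this
  nlinarith [mul_lt_mul_of_pos_left hxu ht]

section Density

variable {n : ℕ} {β : ℝ} {f : (Fin n → ℝ) → ℝ}

theorem rpow_neg_inv_lt_iff (hβ : 0 < β) {a u : ℝ} (ha : 0 < a) (hu : 0 < u) :
    a ^ (-1 / β) < u ↔ u ^ (-β) < a := by
  have e : a = (a ^ (-1 / β)) ^ (-β) := by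
    rw [← Real.rpow_mul ha.le]
    have : -1 / β * -β = 1 := by field_simp
    rw [this, Real.rpow_one]
  conv_rhs => rw [e]
  exact (Real.rpow_lt_rpow_iff_of_neg hu (Real.rpow_pos_of_pos ha _) (by linarith)).symm

theorem aemeasurable_of_convexOn_rpow (hβ : 0 < β) (hf_nonneg : ∀ x, 0 ≤ f x)
    (hf_conv : ConvexOn ℝ {x | 0 < f x} (fun x => f x ^ (-1 / β))) :
    AEMeasurable f volume := by
  refine NullMeasurable.aemeasurable ?_
  refine @measurable_of_Ioi ℝ (NullMeasurableSpace (Fin n → ℝ) volume) _ _ _ _ _ _ _ f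
    fun r => ?_
  change NullMeasurableSet (f ⁻¹' Set.Ioi r) volume
  rcases lt_trichotomy r 0 with hr | rfl | hr
  · have : f ⁻¹' Set.Ioi r = Set.univ :=
      Set.eq_univ_of_forall fun x => hr.trans_le (hf_nonneg x)
    rw [this]
    exact nullMeasurableSet_univ
  · exact hf_conv.1.nullMeasurableSet volume
  · have : f ⁻¹' Set.Ioi r = {x | x ∈ {x | 0 < f x} ∧ f x ^ (-1 / β) < r ^ (-1 / β)} := by
      ext x
      simp only [Set.mem_preimage, Set.mem_Ioi, Set.mem_ofPred_eq]
      have hneg : -1 / β < 0 := div_neg_of_neg_of_pos (by norm_num) hβ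
      constructor
      · intro h
        exact ⟨hr.trans h, Real.rpow_lt_rpow_of_neg hr h hneg⟩
      · rintro ⟨h0, h⟩
        exact (Real.rpow_lt_rpow_iff_of_neg h0 hr hneg).mp h
    rw [this]
    exact (hf_conv.convex_lt _).nullMeasurableSet volume

theorem volume_sublevel_rpow_le (hβ : 0 < β) (hfm : AEMeasurable f volume)
    (hf_int : ∫⁻ x, ENNReal.ofReal (f x) = 1) {u : ℝ} (hu : 0 < u) :
    volume {x | x ∈ {x | 0 < f x} ∧ f x ^ (-1 / β) < u} ≤ ENNReal.ofReal (u ^ β) := by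
  have hsub : {x | x ∈ {x | 0 < f x} ∧ f x ^ (-1 / β) < u} ⊆
      {x | ENNReal.ofReal (u ^ (-β)) ≤ ENNReal.ofReal (f x)} := by
    rintro x ⟨h0, h⟩
    exact ENNReal.ofReal_le_ofReal ((rpow_neg_inv_lt_iff hβ h0 hu).mp h).le
  have h := mul_meas_ge_le_lintegral₀ hfm.ennreal_ofReal (ENNReal.ofReal (u ^ (-β)))
  rw [hf_int] at h
  refine (measure_mono hsub).trans ?_
  have hpos : 0 < u ^ (-β) := Real.rpow_pos_of_pos hu _
  have := (ENNReal.le_div_iff_mul_le (Or.inl (ENNReal.ofReal_pos.mpr hpos).ne')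
    (Or.inl ENNReal.ofReal_ne_top)).mpr (mul_comm (ENNReal.ofReal (u ^ (-β))) _ ▸ h)
  rwa [one_div, ← ENNReal.ofReal_inv_of_pos hpos, ← Real.rpow_neg hu.le, neg_neg] at this

/-- A density `f` with `f^{-1/β}` convex, `β > n`, is bounded. -/
theorem exists_pos_le_rpow_neg (hβ : (n : ℝ) < β) (hf_nonneg : ∀ x, 0 ≤ f x)
    (hf_int : ∫⁻ x, ENNReal.ofReal (f x) = 1)
    (hf_conv : ConvexOn ℝ {x | 0 < f x} (fun x => f x ^ (-1 / β))) :
    ∃ c : ℝ, 0 < c ∧ ∀ x, 0 < f x → c ≤ f x ^ (-1 / β) := by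
  have hβ0 : 0 < β := (Nat.cast_nonneg n).trans_lt hβ
  have hfm := aemeasurable_of_convexOn_rpow hβ0 hf_nonneg hf_conv
  obtain ⟨N, hN⟩ : ∃ N : ℕ, volume {x | x ∈ {x | 0 < f x} ∧ f x ^ (-1 / β) < (N : ℝ)} ≠ 0 := by
    by_contra! hall
    have hK : volume {x | 0 < f x} = 0 := by
      refine measure_mono_null (fun x hx => ?_) (measure_iUnion_null hall)
      obtain ⟨N, hN⟩ := exists_nat_gt (f x ^ (-1 / β))
      exact Set.mem_iUnion.mpr ⟨N, hx, hN⟩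
    have : ∫⁻ x, ENNReal.ofReal (f x) = 0 := by
      rw [lintegral_eq_zero_iff' hfm.ennreal_ofReal]
      filter_upwards [measure_eq_zero_iff_ae_notMem.mp hK] with x hx
      simpa using hx
    simp [this] at hf_int
  set U : ℝ := (N : ℝ)
  have hU : 0 < U := by
    obtain ⟨x, hx0, hx⟩ := nonempty_of_measure_ne_zero hN
    exact (Real.rpow_pos_of_pos hx0 _).trans hx
  set V : ℝ → ENNReal := fun u => volume {x | x ∈ {x | 0 < f x} ∧ f x ^ (-1 / β) < u}
  have hVle : ∀ u, 0 < u → V u ≤ ENNReal.ofReal (u ^ β) :=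
    fun u hu => volume_sublevel_rpow_le hβ0 hfm hf_int hu
  have hVfin : V U ≠ ⊤ := ((hVle U hU).trans_lt ENNReal.ofReal_lt_top).ne
  set D : ℝ := (V U).toReal
  have hD : 0 < D := ENNReal.toReal_pos hN hVfin
  set b : ℝ := D / (U ^ n * 2 ^ β) with hb
  have hb0 : 0 < b := by positivity
  refine ⟨min (U / 2) (b ^ (β - n)⁻¹), lt_min (by positivity) (by positivity), fun y hy => ?_⟩
  set a : ℝ := f y ^ (-1 / β) with ha
  have ha0 : 0 < a := Real.rpow_pos_of_pos hy _
  rcases le_or_gt (U / 2) a with h | h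
  · exact (min_le_left _ _).trans h
  refine (min_le_right _ _).trans ?_
  have hUa : 0 < U - a := by linarith
  have h1 := hf_conv.pow_mul_volume_sublevel_le (y := y) hy (t := a / (U - a)) (by positivity)
    ((div_le_one hUa).mpr (by linarith)) U
  have e : (1 - a / (U - a)) * a + a / (U - a) * U = 2 * a := by field_simp; ring
  simp only [← ha] at h1
  rw [e] at h1
  have h2 : ENNReal.ofReal ((a / (U - a)) ^ n) * V U ≤ ENNReal.ofReal ((2 * a) ^ β) :=
    h1.trans (hVle (2 * a) (by positivity))
  have h3 : (a / (U - a)) ^ n * D ≤ (2 * a) ^ β := by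
    rw [← ENNReal.ofReal_toReal hVfin, ← ENNReal.ofReal_mul (by positivity)] at h2
    exact (ENNReal.ofReal_le_ofReal_iff (by positivity)).mp h2
  have h4 : (a / U) ^ n * D ≤ (2 * a) ^ β := by
    refine le_trans ?_ h3
    gcongr
    linarith
  have h5 : b ≤ a ^ (β - n) := by
    rw [Real.rpow_sub ha0, Real.rpow_natCast, hb, div_le_div_iff₀ (by positivity) (by positivity)]
    rw [Real.mul_rpow (by norm_num) ha0.le, div_pow, div_mul_eq_mul_div,
      div_le_iff₀ (by positivity)] at h4
    nlinarith
  have hpos : 0 < β - n := by linarith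
  calc b ^ (β - n)⁻¹ ≤ (a ^ (β - n)) ^ (β - n)⁻¹ := by gcongr
    _ = a := by rw [← Real.rpow_mul ha0.le, mul_inv_cancel₀ hpos.ne', Real.rpow_one]

/-- Integrated form of the entropy bound at a fixed point `y` of the support of `f`. -/
theorem integral_density_mul_nonneg (hβ : (n : ℝ) < β) (hf_nonneg : ∀ x, 0 ≤ f x)
    (hf_int : ∫⁻ x, ENNReal.ofReal (f x) = 1)
    (hf_conv : ConvexOn ℝ {x | 0 < f x} (fun x => f x ^ (-1 / β)))
    {y : Fin n → ℝ} (hy : 0 < f y) :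
    Integrable (fun x => f x * (∑ i ∈ Finset.Icc 1 n, (β - (i : ℝ))⁻¹ +
      (log (f x) - log (f y)) / β)) ∧
    0 ≤ ∫ x, f x * (∑ i ∈ Finset.Icc 1 n, (β - (i : ℝ))⁻¹ + (log (f x) - log (f y)) / β) := by
  have hβ0 : 0 < β := (Nat.cast_nonneg n).trans_lt hβ
  have hfm := aemeasurable_of_convexOn_rpow hβ0 hf_nonneg hf_conv
  obtain ⟨c, hc, hcφ⟩ := exists_pos_le_rpow_neg hβ hf_nonneg hf_int hf_conv
  set S := ∑ i ∈ Finset.Icc 1 n, (β - (i : ℝ))⁻¹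
  set K : Set (Fin n → ℝ) := {x | 0 < f x}
  have hKm : NullMeasurableSet K volume := hf_conv.1.nullMeasurableSet volume
  set a : ℝ := f y ^ (-1 / β) with ha
  have ha0 : 0 < a := Real.rpow_pos_of_pos hy _
  set ψ : (Fin n → ℝ) → ℝ := fun x => f x ^ (-1 / β) / a with hψ
  have hψm : AEMeasurable ψ (volume.restrict K) :=
    ((hfm.pow_const _).div_const a).restrict
  have hψlt : ∀ x u, ψ x < u ↔ f x ^ (-1 / β) < a * u := fun x u => by
    rw [hψ]; simp only; rw [div_lt_iff₀ ha0, mul_comm]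
  have hmap : ∀ u, (volume.restrict K).map ψ (Set.Iio u) =
      volume {x | x ∈ K ∧ f x ^ (-1 / β) < a * u} := by
    intro u
    rw [Measure.map_apply_of_aemeasurable hψm measurableSet_Iio,
      Measure.restrict_apply₀ (hψm.nullMeasurable measurableSet_Iio)]
    congr 1
    ext x
    simp only [Set.mem_inter_iff, Set.mem_preimage, Set.mem_Iio, hψlt, Set.mem_ofPred_eq]
    exact and_comm
  set ν := (volume.restrict K).map ψ
  have hempty : ∀ u, u ≤ c / a → ν (Set.Iio u) = 0 := by
    intro u hu
    rw [hmap]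
    convert measure_empty (μ := (volume : Measure (Fin n → ℝ)))
    refine Set.eq_empty_of_forall_notMem ?_
    rintro x ⟨hx, hlt⟩
    rw [le_div_iff₀ ha0] at hu
    linarith [hcφ x hx]
  have hfin : ∀ u, ν (Set.Iio u) ≠ ⊤ := by
    intro u
    rcases le_or_gt u (c / a) with h | h
    · rw [hempty u h]; exact ENNReal.zero_ne_top
    · have hu : 0 < a * u := mul_pos ha0 ((div_pos hc ha0).trans h)
      rw [hmap]
      exact ((volume_sublevel_rpow_le hβ0 hfm hf_int hu).trans_lt ENNReal.ofReal_lt_top).ne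
  obtain ⟨hI, hpos⟩ := integral_rpow_neg_mul_log_le ν n (c := min (c / a) 1) hβ
    (lt_min (by positivity) one_pos) (min_le_right _ _) (hempty _ (min_le_left _ _)) hfin
    (by
      intro t u ht ht1 _
      have h := hf_conv.pow_mul_volume_sublevel_le (y := y) hy ht ht1 (a * u)
      have e : (1 - t) * f y ^ (-1 / β) + t * (a * u) = a * (1 - t + t * u) := by
        rw [← ha]; ring
      simp only [e] at h
      rw [← hmap, ← hmap] at h
      have h' := ENNReal.toReal_mono (hfin _) h
      rwa [ENNReal.toReal_mul, ENNReal.toReal_ofReal (by positivity)] at h')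
  have hqm : Measurable fun v : ℝ => v ^ (-β) * (S - log v) := by fun_prop
  rw [integrable_map_measure hqm.aestronglyMeasurable hψm] at hI
  rw [integral_map hψm hqm.aestronglyMeasurable] at hpos
  have hcongr : ∀ x ∈ K, f x * (S + (log (f x) - log (f y)) / β) =
      f y * (ψ x ^ (-β) * (S - log (ψ x))) := by
    intro x hx
    have hx0 : 0 < f x := hx
    have hpow : ∀ z : ℝ, 0 < z → (z ^ (-1 / β)) ^ (-β) = z := by
      intro z hz
      have : -1 / β * -β = 1 := by field_simp
      rw [← Real.rpow_mul hz.le, this, Real.rpow_one]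
    have e1 : ψ x ^ (-β) = f x / f y := by
      rw [hψ]; simp only
      rw [Real.div_rpow (by positivity) ha0.le, hpow _ hx0, ha, hpow _ hy]
    have e2 : log (ψ x) = -(log (f x) - log (f y)) / β := by
      rw [hψ]; simp only
      rw [Real.log_div (Real.rpow_pos_of_pos hx0 _).ne' ha0.ne', ha, Real.log_rpow hx0,
        Real.log_rpow hy]
      ring
    rw [e1, e2]
    field_simp
    ring
  have hsupp : Function.support (fun x => f x * (S + (log (f x) - log (f y)) / β)) ⊆ K := by
    intro x hx
    refine (hf_nonneg x).lt_of_ne' fun h => hx ?_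
    simp [h]
  have hae : ∀ᵐ x ∂volume.restrict K, f x * (S + (log (f x) - log (f y)) / β) =
      f y * (ψ x ^ (-β) * (S - log (ψ x))) := by
    filter_upwards [ae_restrict_mem₀ hKm] with x hx using hcongr x hx
  constructor
  · rw [← integrableOn_iff_integrable_of_support_subset hsupp]
    exact (hI.const_mul (f y)).congr (hae.mono fun x hx => hx.symm)
  · rw [← setIntegral_eq_integral_of_forall_compl_eq_zero (s := K)
      (fun x hx => by_contra fun h => hx (hsupp h)), integral_congr_ae hae, integral_const_mul]
    exact mul_nonneg hy.le hpos

end Density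

/-- Let `β > n` and let `X` be a random vector in `ℝⁿ` with `(-1/β)`-concave
density `f`. Then almost surely `-log f(X) - h(X) ≥ -β ∑_{i=1}^n (β-i)⁻¹`, where
`h(X) = E[-log f(X)]` is the entropy. -/
theorem stmt17
    {Ω : Type*} [MeasureSpace Ω] [IsProbabilityMeasure (ℙ : Measure Ω)]
    (n : ℕ) (β : ℝ) (hβ : (n : ℝ) < β)
    (X : Ω → (Fin n → ℝ)) (hX : Measurable X)
    (f : (Fin n → ℝ) → ℝ) (hf_nonneg : ∀ x, 0 ≤ f x)
    (hf_density : Measure.map X ℙ = volume.withDensity (fun x => ENNReal.ofReal (f x)))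
    (hf_conv : ConvexOn ℝ {x | 0 < f x} (fun x => f x ^ (-1 / β))) :
    ∀ᵐ ω ∂(ℙ : Measure Ω),
      -β * ∑ i ∈ Finset.Icc 1 n, (β - (i : ℝ))⁻¹
        ≤ -Real.log (f (X ω)) - ∫ ω', -Real.log (f (X ω')) := by
  have hβ0 : 0 < β := (Nat.cast_nonneg n).trans_lt hβ
  have hfm := aemeasurable_of_convexOn_rpow hβ0 hf_nonneg hf_conv
  have hprob : IsProbabilityMeasure (Measure.map X ℙ) :=
    Measure.isProbabilityMeasure_map hX.aemeasurable
  have hf_int : ∫⁻ x, ENNReal.ofReal (f x) = 1 := by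
    have h := hprob.measure_univ
    rwa [hf_density, withDensity_apply _ MeasurableSet.univ, Measure.restrict_univ] at h
  have hae : ∀ᵐ ω ∂(ℙ : Measure Ω), 0 < f (X ω) := by
    refine ae_of_ae_map hX.aemeasurable (p := fun x => 0 < f x) ?_
    rw [hf_density, ae_withDensity_iff' hfm.ennreal_ofReal]
    refine Filter.Eventually.of_forall fun x hx => ?_
    exact (hf_nonneg x).lt_of_ne' fun h => hx (by simp [h])
  have hlogm : AEStronglyMeasurable (fun x => log (f x)) (Measure.map X ℙ) := by
    rw [hf_density]
    exact ((Real.measurable_log.comp_aemeasurable hfm).mono_ac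
      (withDensity_absolutelyContinuous _ _)).aestronglyMeasurable
  have hE : ∫ ω', -log (f (X ω')) = -∫ x, log (f x) ∂(Measure.map X ℙ) := by
    rw [integral_neg, integral_map hX.aemeasurable hlogm]
  filter_upwards [hae] with ω hω
  obtain ⟨hI, hpos⟩ := integral_density_mul_nonneg hβ hf_nonneg hf_int hf_conv hω
  rw [hE]
  set S := ∑ i ∈ Finset.Icc 1 n, (β - (i : ℝ))⁻¹
  set μ := Measure.map X ℙ
  have hG : Integrable (fun x => S + (log (f x) - log (f (X ω))) / β) μ := by
    rw [hf_density, integrable_withDensity_iff_integrable_smul₀' hfm.ennreal_ofReal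
      (Filter.Eventually.of_forall fun x => ENNReal.ofReal_lt_top)]
    simpa only [ENNReal.toReal_ofReal (hf_nonneg _), smul_eq_mul] using hI
  have hG0 : 0 ≤ ∫ x, (S + (log (f x) - log (f (X ω))) / β) ∂μ := by
    rw [hf_density, integral_withDensity_eq_integral_toReal_smul₀ hfm.ennreal_ofReal
      (Filter.Eventually.of_forall fun x => ENNReal.ofReal_lt_top)]
    simpa only [ENNReal.toReal_ofReal (hf_nonneg _), smul_eq_mul] using hpos
  have hlog : ∫ x, log (f x) ∂μ =
      β * ∫ x, (S + (log (f x) - log (f (X ω))) / β) ∂μ + (log (f (X ω)) - β * S) := by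
    rw [← integral_const_mul]
    have hc : ∫ _ : Fin n → ℝ, (log (f (X ω)) - β * S) ∂μ = log (f (X ω)) - β * S := by simp
    rw [← hc, ← integral_add (hG.const_mul β) (integrable_const _)]
    refine integral_congr_ae (Filter.Eventually.of_forall fun x => ?_)
    field_simp
    ring
  nlinarith [mul_nonneg hβ0.le hG0]
end
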